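/- Assume V_m ⊆ H and f ∈ H. Assume (x_1,…,x_n) is drawn from γ_n^ν with ν = wμ and w = α·w_m + (1−α)·h for some 0 < α < 1, n > m, and use weighted least-squares with weight w. Then for 0 < δ < 1: (i) with probability at least 1 − m·exp(−c_δ(n−m)α/m), ‖f − f̂_m‖ ≤ (C_H + (1−δ)^{-1/2}(1−α)^{-1/2}(1 − m/n)^{-1/2})·inf_{g∈V_m}‖f−g‖_H; and (ii) if n ≥ m + c_δ^{-1}α^{-1}m·log(n m²), then E(‖f − f̂_m‖²) ≤ (2C_H² + 2(1−α)^{-1}(1 + (1−δ)^{-1}(1 − m/n)^{-1}))·inf_{g∈V_m}‖f−g‖_H². -/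

import Mathlib

open MeasureTheory ProbabilityTheory Matrix Finset
open scoped ENNReal NNReal BigOperators RealInnerProductSpace

noncomputable section

namespace WLSDPP

variable {𝓧 : Type*} [MeasurableSpace 𝓧]

/-- Smallest eigenvalue of a real symmetric matrix, via the Rayleigh quotient. -/
def lambdaMin {m : ℕ} (A : Matrix (Fin m) (Fin m) ℝ) : ℝ :=
  ⨅ v : {v : Fin m → ℝ // ∑ i, v i ^ 2 = 1}, (v : Fin m → ℝ) ⬝ᵥ A.mulVec v

/-- The feature vector `𝛗(x) = (φ₁(x),…,φ_m(x))ᵀ`. -/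
def feat {m : ℕ} (φ : Fin m → 𝓧 → ℝ) (x : 𝓧) : Fin m → ℝ := fun j => φ j x

/-- Empirical Gram matrix `G^w(x) = (1/n) ∑ᵢ w(xᵢ)⁻¹ 𝛗(xᵢ)𝛗(xᵢ)ᵀ`. -/
def gram {m n : ℕ} (φ : Fin m → 𝓧 → ℝ) (w : 𝓧 → ℝ) (x : Fin n → 𝓧) :
    Matrix (Fin m) (Fin m) ℝ :=
  (n : ℝ)⁻¹ • ∑ i, (w (x i))⁻¹ • vecMulVec (feat φ (x i)) (feat φ (x i))

/-- Empirical seminorm squared `‖f‖ₙ² = (1/n) ∑ᵢ w(xᵢ)⁻¹ f(xᵢ)²`. -/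
def empSq {n : ℕ} (w : 𝓧 → ℝ) (f : 𝓧 → ℝ) (x : Fin n → 𝓧) : ℝ :=
  (n : ℝ)⁻¹ * ∑ i, (w (x i))⁻¹ * f (x i) ^ 2

/-- Squared L²(μ) norm. -/
def l2Sq (μ : Measure 𝓧) (f : 𝓧 → ℝ) : ℝ := ∫ y, f y ^ 2 ∂μ

/-- L²(μ) norm. -/
def l2 (μ : Measure 𝓧) (f : 𝓧 → ℝ) : ℝ := Real.sqrt (l2Sq μ f)

/-- The element of `V_m` with coefficient vector `a`. -/
def lin {m : ℕ} (φ : Fin m → 𝓧 → ℝ) (a : Fin m → ℝ) : 𝓧 → ℝ := fun y => ∑ j, a j * φ j y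

/-- The L²(μ)-orthogonal projection onto `V_m` (for `φ` an orthonormal basis of `V_m`). -/
def projV {m : ℕ} (μ : Measure 𝓧) (φ : Fin m → 𝓧 → ℝ) (f : 𝓧 → ℝ) : 𝓧 → ℝ :=
  lin φ (fun j => ∫ y, φ j y * f y ∂μ)

/-- The right-hand side vector `b = (1/n) ∑ᵢ w(xᵢ)⁻¹ f(xᵢ) 𝛗(xᵢ)`. -/
def bVec {m n : ℕ} (φ : Fin m → 𝓧 → ℝ) (w : 𝓧 → ℝ) (f : 𝓧 → ℝ) (x : Fin n → 𝓧) :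
    Fin m → ℝ :=
  (n : ℝ)⁻¹ • ∑ i, ((w (x i))⁻¹ * f (x i)) • feat φ (x i)

/-- The weighted least-squares projection `P̂_{V_m} f = 𝛗(·)ᵀ (G^w)⁻¹ b`. -/
def lsProj {m n : ℕ} (φ : Fin m → 𝓧 → ℝ) (w : 𝓧 → ℝ) (f : 𝓧 → ℝ) (x : Fin n → 𝓧) :
    𝓧 → ℝ :=
  lin φ ((gram φ w x)⁻¹ *ᵥ bVec φ w f x)

/-- The measure with density `w` with respect to `μ`. -/
def dens (μ : Measure 𝓧) (w : 𝓧 → ℝ) : Measure 𝓧 :=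
  μ.withDensity fun a => ENNReal.ofReal (w a)

/-- The inverse Christoffel density `w_m(x) = (1/m) ‖𝛗(x)‖₂²`. -/
def wChr {m : ℕ} (φ : Fin m → 𝓧 → ℝ) : 𝓧 → ℝ := fun x => (m : ℝ)⁻¹ * ∑ i, φ i x ^ 2

/-- The feature matrix `Φ(x)` with `i`-th row `𝛗(xᵢ)ᵀ`. -/
def featM {m n : ℕ} (φ : Fin m → 𝓧 → ℝ) (x : Fin n → 𝓧) : Matrix (Fin n) (Fin m) ℝ :=
  Matrix.of fun i j => φ j (x i)

/-- The weighted feature matrix `Φ^w(x)` with `i`-th row `w(xᵢ)^{-1/2} 𝛗(xᵢ)ᵀ`. -/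
def featW {m n : ℕ} (φ : Fin m → 𝓧 → ℝ) (w : 𝓧 → ℝ) (x : Fin n → 𝓧) :
    Matrix (Fin n) (Fin m) ℝ :=
  Matrix.of fun i j => (Real.sqrt (w (x i)))⁻¹ * φ j (x i)

/-- The projection DPP `γ_m`, with density `(1/m!) det(Φ(x)ᵀΦ(x))` w.r.t. `μ^⊗m`. -/
def dpp {m : ℕ} (μ : Measure 𝓧) (φ : Fin m → 𝓧 → ℝ) : Measure (Fin m → 𝓧) :=
  (Measure.pi fun _ : Fin m => μ).withDensity fun x =>
    ENNReal.ofReal ((m.factorial : ℝ)⁻¹ * ((featM φ x)ᵀ * featM φ x).det)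

/-- The generalized volume sampling distribution `γ_n^ν`, `ν = wμ`, with density
`n^m ((n−m)!/n!) det(G^w(x))` with respect to `ν^⊗n`. -/
def vs {m : ℕ} (μ : Measure 𝓧) (φ : Fin m → 𝓧 → ℝ) (w : 𝓧 → ℝ) (n : ℕ) :
    Measure (Fin n → 𝓧) :=
  (Measure.pi fun _ : Fin n => dens μ w).withDensity fun x =>
    ENNReal.ofReal ((n : ℝ) ^ m * ((n - m).factorial : ℝ) / (n.factorial : ℝ) *
      (gram φ w x).det)

/-- `c_δ = δ + (1−δ) log(1−δ)`. -/
def cDelta (δ : ℝ) : ℝ := δ + (1 - δ) * Real.log (1 - δ)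

/-- `φ₁, …, φ_m` is an orthonormal system in `L²_μ`. -/
def IsONB {m : ℕ} (μ : Measure 𝓧) (φ : Fin m → 𝓧 → ℝ) : Prop :=
  ∀ i j, ∫ y, φ i y * φ j y ∂μ = if i = j then (1 : ℝ) else 0

end WLSDPP

namespace WLSDPP

section LieTrotter

variable {𝔸 : Type*} [NormedRing 𝔸] [NormOneClass 𝔸]

theorem norm_pow_sub_pow_le {x y : 𝔸} {M : ℝ} (hM : 1 ≤ M) (hx : ‖x‖ ≤ M) (hy : ‖y‖ ≤ M)
    (n : ℕ) : ‖x ^ n - y ^ n‖ ≤ n * M ^ n * ‖x - y‖ := by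
  induction n with
  | zero => simp
  | succ n ih =>
    have key : x ^ (n + 1) - y ^ (n + 1) = x ^ n * (x - y) + (x ^ n - y ^ n) * y := by
      rw [pow_succ, pow_succ]; noncomm_ring
    have hxn : ‖x ^ n‖ ≤ M ^ n :=
      (norm_pow_le x n).trans (pow_le_pow_left₀ (norm_nonneg _) hx n)
    have hM0 : 0 ≤ M ^ n := by positivity
    rw [key]
    calc _ ≤ ‖x ^ n‖ * ‖x - y‖ + ‖x ^ n - y ^ n‖ * ‖y‖ :=
          (norm_add_le _ _).trans (add_le_add (norm_mul_le _ _) (norm_mul_le _ _))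
      _ ≤ M ^ n * ‖x - y‖ + n * M ^ n * ‖x - y‖ * M := by gcongr
      _ ≤ M ^ n * M * ‖x - y‖ + n * M ^ n * ‖x - y‖ * M := by
          gcongr; exact le_mul_of_one_le_right hM0 hM
      _ = _ := by push_cast; ring

variable [NormedAlgebra ℝ 𝔸]

theorem exists_norm_le_one_add_of_hasDerivAt {F : ℝ → 𝔸} {c : 𝔸} (h0 : F 0 = 1)
    (hF : HasDerivAt F c 0) :
    ∃ C : ℝ, 0 ≤ C ∧ ∀ᶠ t in nhds (0 : ℝ), ‖F t‖ ≤ 1 + C * |t| := by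
  obtain ⟨C, hC, hb⟩ := hF.isBigO_sub.exists_pos
  refine ⟨C, hC.le, ?_⟩
  filter_upwards [hb.bound] with t ht
  have : F t = 1 + (F t - F 0) := by rw [h0]; abel
  rw [this]
  refine (norm_add_le _ _).trans ?_
  rw [norm_one]
  simpa [Real.norm_eq_abs] using ht

/-- Two curves through `1` with the same velocity at `0` have asymptotically equal
`n`-fold powers at time `1 / n`. -/
theorem tendsto_pow_sub_pow_of_hasDerivAt {F G : ℝ → 𝔸} {c : 𝔸} (hF0 : F 0 = 1) (hG0 : G 0 = 1)
    (hF : HasDerivAt F c 0) (hG : HasDerivAt G c 0) :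
    Filter.Tendsto (fun n : ℕ => F (n : ℝ)⁻¹ ^ n - G (n : ℝ)⁻¹ ^ n) Filter.atTop (nhds 0) := by
  obtain ⟨C₁, hC₁, h₁⟩ := exists_norm_le_one_add_of_hasDerivAt hF0 hF
  obtain ⟨C₂, hC₂, h₂⟩ := exists_norm_le_one_add_of_hasDerivAt hG0 hG
  have hinv : Filter.Tendsto (fun n : ℕ => (n : ℝ)⁻¹) Filter.atTop (nhds 0) :=
    tendsto_inv_atTop_nhds_zero_nat
  have hlo : (fun t => F t - G t) =o[nhds 0] fun t : ℝ => t := by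
    have := (hF.sub hG).isLittleO
    simpa [hF0, hG0] using this
  rw [Metric.tendsto_atTop']
  intro ε hε
  set C := max C₁ C₂
  have hC : 0 ≤ C := le_max_of_le_left hC₁
  have hε' : 0 < ε / 2 * Real.exp (-C) := by positivity
  have hev := hinv.eventually (((h₁.and h₂).and (hlo.bound hε')))
  obtain ⟨N, hN⟩ := Filter.eventually_atTop.1 hev
  refine ⟨N, fun n hn => ?_⟩
  obtain ⟨⟨ha, hb⟩, hc⟩ := hN n hn.le
  have hn0 : (0 : ℝ) < n := by exact_mod_cast (Nat.zero_le N).trans_lt hn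
  have habs : |(n : ℝ)⁻¹| = (n : ℝ)⁻¹ := abs_of_pos (by positivity)
  rw [habs] at ha hb
  rw [Real.norm_eq_abs, habs] at hc
  have hle : ∀ D, D ≤ C → 1 + D * (n : ℝ)⁻¹ ≤ Real.exp (C * (n : ℝ)⁻¹) := by
    intro D hD
    have h1 : D * (n : ℝ)⁻¹ ≤ C * (n : ℝ)⁻¹ := by gcongr
    have h2 := Real.add_one_le_exp (C * (n : ℝ)⁻¹)
    linarith
  have hM : 1 ≤ Real.exp (C * (n : ℝ)⁻¹) := Real.one_le_exp (by positivity)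
  have := norm_pow_sub_pow_le hM (ha.trans (hle _ (le_max_left _ _)))
    (hb.trans (hle _ (le_max_right _ _))) n
  have hp : Real.exp (C * (n : ℝ)⁻¹) ^ n = Real.exp C := by
    rw [← Real.exp_nat_mul]; congr 1; field_simp
  rw [hp] at this
  rw [dist_zero_right]
  calc _ ≤ _ := this
    _ ≤ n * Real.exp C * (ε / 2 * Real.exp (-C) * (n : ℝ)⁻¹) := by gcongr
    _ = ε / 2 := by rw [Real.exp_neg]; field_simp
    _ < ε := by linarith

/-- The Lie product formula. -/
theorem tendsto_exp_mul_exp_pow [CompleteSpace 𝔸] (a b : 𝔸) :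
    Filter.Tendsto (fun n : ℕ =>
        (NormedSpace.exp ((n : ℝ)⁻¹ • a) * NormedSpace.exp ((n : ℝ)⁻¹ • b)) ^ n)
      Filter.atTop (nhds (NormedSpace.exp (a + b))) := by
  let : NormedAlgebra ℚ 𝔸 := NormedAlgebra.restrictScalars ℚ ℝ 𝔸
  have hd : ∀ c : 𝔸, HasDerivAt (fun t : ℝ => NormedSpace.exp (t • c)) c 0 := fun c => by
    simpa using hasDerivAt_exp_smul_const (𝕂 := ℝ) c (0 : ℝ)
  have h := tendsto_pow_sub_pow_of_hasDerivAt
    (F := fun t : ℝ => NormedSpace.exp (t • a) * NormedSpace.exp (t • b))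
    (G := fun t : ℝ => NormedSpace.exp (t • (a + b))) (c := a + b) (by simp) (by simp)
    (by simpa [Pi.mul_def] using (hd a).mul (hd b)) (hd _)
  have h' : Filter.Tendsto (fun n : ℕ => (NormedSpace.exp ((n : ℝ)⁻¹ • (a + b))) ^ n)
      Filter.atTop (nhds (NormedSpace.exp (a + b))) := by
    refine tendsto_const_nhds.congr' ?_
    filter_upwards [Filter.eventually_gt_atTop 0] with n hn
    rw [← NormedSpace.exp_nsmul, ← Nat.cast_smul_eq_nsmul ℝ, smul_smul, mul_inv_cancel₀, one_smul]
    exact_mod_cast hn.ne'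
  simpa using h.add h'

end LieTrotter

section GoldenThompson

variable {ι : Type*} [Fintype ι]

theorem trace_mul_self_le_trace_transpose_mul (Z : Matrix ι ι ℝ) :
    (Z * Z).trace ≤ (Zᵀ * Z).trace := by
  have h : 0 ≤ ((Z - Zᵀ)ᵀ * (Z - Zᵀ)).trace := by
    simp only [Matrix.trace, Matrix.diag, Matrix.mul_apply, Matrix.transpose_apply]
    exact Finset.sum_nonneg fun i _ => Finset.sum_nonneg fun j _ => mul_self_nonneg _
  have h1 : ((Z - Zᵀ)ᵀ * (Z - Zᵀ)) = Zᵀ * Z - Zᵀ * Zᵀ - Z * Z + Z * Zᵀ := by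
    rw [Matrix.transpose_sub, Matrix.transpose_transpose]; noncomm_ring
  have h2 : (Zᵀ * Zᵀ).trace = (Z * Z).trace := by
    rw [← Matrix.transpose_mul, Matrix.trace_transpose]
  have h3 : (Z * Zᵀ).trace = (Zᵀ * Z).trace := Matrix.trace_mul_comm _ _
  rw [h1, Matrix.trace_add, Matrix.trace_sub, Matrix.trace_sub, h2, h3] at h
  linarith

variable [DecidableEq ι]

theorem trace_mul_pow_comm (A B : Matrix ι ι ℝ) (q : ℕ) :
    ((A * B) ^ q).trace = ((B * A) ^ q).trace := by
  cases q with
  | zero => simp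
  | succ q =>
    have : (A * B) ^ (q + 1) = A * ((B * A) ^ q * B) := by
      induction q with
      | zero => simp
      | succ q ih => rw [pow_succ', ih, pow_succ' (B * A) q]; noncomm_ring
    rw [this, Matrix.trace_mul_comm, pow_succ]; congr 1; noncomm_ring

/-- The trace inequalities of Golden and Thompson for `2 ^ j`-th powers. -/
theorem trace_pow_two_pow_le (j : ℕ) :
    (∀ Z : Matrix ι ι ℝ, (Z ^ (2 ^ (j + 1))).trace ≤ ((Zᵀ * Z) ^ (2 ^ j)).trace) ∧
    (∀ X Y : Matrix ι ι ℝ, X.IsSymm → Y.IsSymm →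
      ((X * Y) ^ (2 ^ j)).trace ≤ (X ^ (2 ^ j) * Y ^ (2 ^ j)).trace) := by
  induction j with
  | zero =>
    refine ⟨fun Z => ?_, fun X Y _ _ => by simp⟩
    simpa [pow_two] using trace_mul_self_le_trace_transpose_mul Z
  | succ j ih =>
    obtain ⟨ihZ, ihXY⟩ := ih
    refine ⟨fun Z => ?_, fun X Y hX hY => ?_⟩
    · set P := Zᵀ * Z
      set Q := Z * Zᵀ
      have hP : P.IsSymm := Matrix.isSymm_transpose_mul_self Z
      have hQ : Q.IsSymm := Matrix.isSymm_mul_transpose_self Z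
      have e1 : ((Z ^ 2)ᵀ * Z ^ 2) = Zᵀ * (P * Z) := by
        simp only [P, pow_two, Matrix.transpose_mul]; noncomm_ring
      have e2 : P * Z * Zᵀ = P * Q := by simp only [P, Q]; noncomm_ring
      have h1 : (Z ^ (2 ^ (j + 1 + 1))).trace ≤ ((P * Q) ^ (2 ^ j)).trace := by
        have := ihZ (Z ^ 2)
        rw [← pow_mul, ← pow_succ', e1, trace_mul_pow_comm, e2] at this
        exact this
      have h2 := ihXY P Q hP hQ
      have h3 : (P ^ (2 ^ j) * Q ^ (2 ^ j)).trace ≤ (P ^ 2 ^ (j + 1)).trace := by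
        have hs : 0 ≤ ((P ^ 2 ^ j - Q ^ 2 ^ j)ᵀ * (P ^ 2 ^ j - Q ^ 2 ^ j)).trace := by
          simp only [Matrix.trace, Matrix.diag, Matrix.mul_apply, Matrix.transpose_apply]
          exact Finset.sum_nonneg fun i _ => Finset.sum_nonneg fun j _ => mul_self_nonneg _
        have e : (P ^ 2 ^ j - Q ^ 2 ^ j)ᵀ * (P ^ 2 ^ j - Q ^ 2 ^ j) =
            P ^ 2 ^ (j + 1) - P ^ 2 ^ j * Q ^ 2 ^ j - Q ^ 2 ^ j * P ^ 2 ^ j + Q ^ 2 ^ (j + 1) := by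
          rw [Matrix.transpose_sub, (hP.pow _).eq, (hQ.pow _).eq, pow_succ, pow_mul, pow_mul,
            pow_two, pow_two]
          noncomm_ring
        have e3 : (Q ^ 2 ^ (j + 1)).trace = (P ^ 2 ^ (j + 1)).trace := trace_mul_pow_comm _ _ _
        rw [e, Matrix.trace_add, Matrix.trace_sub, Matrix.trace_sub, e3,
          Matrix.trace_mul_comm (Q ^ 2 ^ j)] at hs
        linarith
      exact h1.trans (h2.trans h3)
    · have h1 := ihZ (X * Y)
      have e1 : (X * Y)ᵀ * (X * Y) = Y * (X ^ 2 * Y) := by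
        rw [Matrix.transpose_mul, hX.eq, hY.eq, pow_two]; noncomm_ring
      have e2 : X ^ 2 * Y * Y = X ^ 2 * Y ^ 2 := by rw [pow_two Y]; noncomm_ring
      rw [e1, trace_mul_pow_comm Y, e2] at h1
      have h2 := ihXY (X ^ 2) (Y ^ 2) (hX.pow 2) (hY.pow 2)
      rw [← pow_mul, ← pow_mul, ← pow_succ'] at h2
      exact h1.trans h2

section
open scoped Matrix.Norms.Operator

theorem continuous_matrix_exp : Continuous (NormedSpace.exp : Matrix ι ι ℝ → Matrix ι ι ℝ) :=
  let : NormedAlgebra ℚ (Matrix ι ι ℝ) := NormedAlgebra.restrictScalars ℚ ℝ _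
  NormedSpace.exp_continuous

theorem tendsto_matrix_exp_mul_exp_pow [Nonempty ι] (A B : Matrix ι ι ℝ) :
    Filter.Tendsto (fun n : ℕ =>
        (NormedSpace.exp ((n : ℝ)⁻¹ • A) * NormedSpace.exp ((n : ℝ)⁻¹ • B)) ^ n)
      Filter.atTop (nhds (NormedSpace.exp (A + B))) :=
  tendsto_exp_mul_exp_pow A B

/-- The exponential of a multiple of an idempotent. -/
theorem matrix_exp_smul_of_idem {E : Matrix ι ι ℝ} (hE : E * E = E) (c : ℝ) :
    NormedSpace.exp (c • E) = 1 + (Real.exp c - 1) • E := by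
  let : NormedAlgebra ℚ (Matrix ι ι ℝ) := NormedAlgebra.restrictScalars ℚ ℝ _
  have hpow : ∀ n : ℕ, E ^ (n + 1) = E := fun n => by
    induction n with
    | zero => simp
    | succ n ih => rw [pow_succ, ih, hE]
  have h1 := NormedSpace.exp_series_hasSum_exp' (𝕂 := ℝ) (c • E)
  have h2 := (NormedSpace.exp_series_hasSum_exp' (𝕂 := ℝ) c).smul_const E
  have h3 := (hasSum_ite_eq (0 : ℕ) (1 - E : Matrix ι ι ℝ)).add h2
  rw [← Real.exp_eq_exp_ℝ] at h3
  have hfun : (fun n : ℕ => (n.factorial⁻¹ : ℝ) • (c • E) ^ n) =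
      fun n : ℕ => (if n = 0 then (1 - E) else 0) + ((n.factorial⁻¹ : ℝ) • c ^ n) • E := by
    funext n
    cases n with
    | zero => simp
    | succ n => simp [smul_pow, hpow, smul_smul]
  rw [hfun] at h1
  refine (h1.unique h3).trans ?_
  · rw [sub_smul, one_smul]; abel
end

/-- The **Golden-Thompson inequality**. -/
theorem trace_exp_add_le [Nonempty ι] {A B : Matrix ι ι ℝ} (hA : A.IsSymm) (hB : B.IsSymm) :
    (NormedSpace.exp (A + B)).trace ≤ (NormedSpace.exp A * NormedSpace.exp B).trace := by
  have hlim := (tendsto_matrix_exp_mul_exp_pow A B).comp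
    (tendsto_pow_atTop_atTop_of_one_lt (one_lt_two : 1 < 2))
  have hlim' := ((continuous_id.matrix_trace (n := ι) (R := ℝ)).tendsto _).comp hlim
  refine le_of_tendsto' hlim' fun k => ?_
  simp only [Function.comp_apply, id]
  have hpow : ∀ C : Matrix ι ι ℝ,
      NormedSpace.exp (((2 ^ k : ℕ) : ℝ)⁻¹ • C) ^ (2 ^ k) = NormedSpace.exp C := fun C => by
    rw [← Matrix.exp_nsmul, ← Nat.cast_smul_eq_nsmul ℝ, smul_smul, mul_inv_cancel₀, one_smul]
    positivity
  have := (trace_pow_two_pow_le k).2 (NormedSpace.exp (((2 ^ k : ℕ) : ℝ)⁻¹ • A))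
    (NormedSpace.exp (((2 ^ k : ℕ) : ℝ)⁻¹ • B)) (hA.smul _).exp (hB.smul _).exp
  rwa [hpow, hpow] at this

end GoldenThompson

section RankOne

variable {ι : Type*}

theorem vecMulVec_self_isSymm (v : ι → ℝ) : (vecMulVec v v).IsSymm := by
  ext i j; simp [vecMulVec_apply, mul_comm]

variable [Fintype ι] [DecidableEq ι]

theorem matrix_exp_smul_vecMulVec (v : ι → ℝ) (hv : v ⬝ᵥ v ≠ 0) (c : ℝ) :
    NormedSpace.exp (c • vecMulVec v v) =
      1 + ((Real.exp (c * (v ⬝ᵥ v)) - 1) / (v ⬝ᵥ v)) • vecMulVec v v := by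
  have hE : ((v ⬝ᵥ v)⁻¹ • vecMulVec v v) * ((v ⬝ᵥ v)⁻¹ • vecMulVec v v) =
      (v ⬝ᵥ v)⁻¹ • vecMulVec v v := by
    rw [smul_mul_smul_comm, vecMulVec_mul_vecMulVec, vecMulVec_smul, smul_smul]
    congr 1; field_simp
  have := matrix_exp_smul_of_idem hE (c * (v ⬝ᵥ v))
  rw [smul_smul, smul_smul] at this
  rw [div_eq_mul_inv, ← this]
  congr 2; field_simp

theorem dotProduct_matrix_exp_nonneg {Q : Matrix ι ι ℝ} (hQ : Q.IsSymm) (v : ι → ℝ) :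
    0 ≤ v ⬝ᵥ (NormedSpace.exp Q *ᵥ v) := by
  have h : NormedSpace.exp Q = (NormedSpace.exp ((2 : ℝ)⁻¹ • Q))ᵀ *
      NormedSpace.exp ((2 : ℝ)⁻¹ • Q) := by
    rw [(hQ.smul _).exp.eq, ← pow_two, ← Matrix.exp_nsmul, ← Nat.cast_smul_eq_nsmul ℝ, smul_smul]
    simp
  rw [h, ← mulVec_mulVec, dotProduct_mulVec, vecMul_transpose]
  exact Finset.sum_nonneg fun i _ => mul_self_nonneg _

theorem trace_matrix_exp_nonneg {Q : Matrix ι ι ℝ} (hQ : Q.IsSymm) :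
    0 ≤ (NormedSpace.exp Q).trace := by
  refine Finset.sum_nonneg fun i _ => ?_
  simpa using dotProduct_matrix_exp_nonneg hQ (Pi.single i 1)

/-- Chord bound for the decreasing exponential. -/
theorem one_sub_exp_ge {θ K s : ℝ} (hK : 0 < K) (hs : 0 ≤ s) (hsK : s ≤ K) :
    s * ((1 - Real.exp (-(θ * K))) / K) ≤ 1 - Real.exp (-(θ * s)) := by
  have h := convexOn_exp.2 (Set.mem_univ 0) (Set.mem_univ (-(θ * K)))
    (sub_nonneg.2 ((div_le_one hK).2 hsK)) (div_nonneg hs hK.le) (by ring)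
  simp only [smul_eq_mul, mul_zero, zero_add, Real.exp_zero, mul_one] at h
  have e : s / K * -(θ * K) = -(θ * s) := by field_simp
  rw [e] at h
  have e2 : s * ((1 - Real.exp (-(θ * K))) / K) = s / K - s / K * Real.exp (-(θ * K)) := by ring
  linarith

/-- Effect of a rank-one update on the trace exponential. -/
theorem trace_exp_add_rankOne_le [Nonempty ι] {Q : Matrix ι ι ℝ} (hQ : Q.IsSymm) {θ K : ℝ}
    (hK : 0 < K) (v : ι → ℝ) (hv : v ⬝ᵥ v ≤ K) :
    (NormedSpace.exp (Q + (-θ) • vecMulVec v v)).trace ≤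
      (NormedSpace.exp Q).trace -
        (1 - Real.exp (-(θ * K))) / K * (v ⬝ᵥ (NormedSpace.exp Q *ᵥ v)) := by
  by_cases hv0 : v ⬝ᵥ v = 0
  · have : v = 0 := dotProduct_self_eq_zero.1 hv0
    simp [this]
  have hs : 0 ≤ v ⬝ᵥ v := Finset.sum_nonneg fun i _ => mul_self_nonneg _
  have hs' : 0 < v ⬝ᵥ v := lt_of_le_of_ne hs (Ne.symm hv0)
  refine (trace_exp_add_le hQ ((vecMulVec_self_isSymm v).smul _)).trans ?_
  have htr : (NormedSpace.exp Q * vecMulVec v v).trace = v ⬝ᵥ (NormedSpace.exp Q *ᵥ v) := by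
    rw [mul_vecMulVec, trace_vecMulVec, dotProduct_comm]
  rw [matrix_exp_smul_vecMulVec v hv0, mul_add, mul_one, mul_smul_comm, trace_add, trace_smul, htr,
    smul_eq_mul]
  have hP := dotProduct_matrix_exp_nonneg hQ v
  have h1 := one_sub_exp_ge (θ := θ) hK hs hv
  have h2 : (1 - Real.exp (-(θ * K))) / K ≤ -((Real.exp (-θ * (v ⬝ᵥ v)) - 1) / (v ⬝ᵥ v)) := by
    rw [← neg_div, le_div_iff₀ hs', mul_comm, neg_mul]; linarith
  nlinarith [mul_le_mul_of_nonneg_right h2 hP]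

theorem exp_neg_le_trace_exp {A : Matrix ι ι ℝ} (hA : A.IsSymm) {θ a : ℝ} (hθ : 0 ≤ θ)
    {v : ι → ℝ} (hva : v ⬝ᵥ (A *ᵥ v) < a * (v ⬝ᵥ v)) :
    Real.exp (-(θ * a)) ≤ (NormedSpace.exp ((-θ) • A)).trace := by
  have hH : A.IsHermitian := by
    rw [Matrix.IsHermitian, conjTranspose_eq_transpose_of_trivial]; exact hA
  set U : Matrix ι ι ℝ := (hH.eigenvectorUnitary).1 with hU
  have hUU : U * Uᵀ = 1 := by
    have := Unitary.mul_star_self_of_mem hH.eigenvectorUnitary.2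
    rwa [star_eq_conjTranspose, conjTranspose_eq_transpose_of_trivial] at this
  have hUU' : Uᵀ * U = 1 := mul_eq_one_comm.1 hUU
  have hinv : U⁻¹ = Uᵀ := inv_eq_right_inv hUU
  have hspec : A = U * diagonal hH.eigenvalues * Uᵀ := by
    have := hH.spectral_theorem
    rw [Unitary.conjStarAlgAut_apply] at this
    simpa [star_eq_conjTranspose] using! this
  have hexp : NormedSpace.exp ((-θ) • A) =
      U * diagonal (fun i => Real.exp (-θ * hH.eigenvalues i)) * Uᵀ := by
    have h1 : (-θ) • A = U * diagonal (fun i => -θ * hH.eigenvalues i) * U⁻¹ := by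
      rw [hinv]
      conv_lhs => rw [hspec]
      rw [← smul_mul_assoc, ← mul_smul_comm]
      congr 2
      ext i j; simp [diagonal_apply]
    rw [h1, exp_conj _ _ (.of_mul_eq_one _ hUU), hinv, exp_diagonal]
    congr 3
    funext i
    rw [Pi.coe_exp, Real.exp_eq_exp_ℝ]
  have htr : (NormedSpace.exp ((-θ) • A)).trace = ∑ i, Real.exp (-θ * hH.eigenvalues i) := by
    rw [hexp, mul_assoc, trace_mul_comm, mul_assoc, hUU', mul_one, trace_diagonal]
  have hex : ∃ i, hH.eigenvalues i ≤ a := by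
    by_contra! hcon
    have e1 : v ⬝ᵥ (A *ᵥ v) = ∑ i, hH.eigenvalues i * (Uᵀ *ᵥ v) i ^ 2 := by
      conv_lhs => rw [hspec]
      rw [← mulVec_mulVec, ← mulVec_mulVec, dotProduct_mulVec, ← mulVec_transpose]
      simp only [dotProduct, mulVec_diagonal]
      exact Finset.sum_congr rfl fun i _ => by ring
    have e2 : v ⬝ᵥ v = ∑ i, (Uᵀ *ᵥ v) i ^ 2 := by
      have : v ⬝ᵥ v = (Uᵀ *ᵥ v) ⬝ᵥ (Uᵀ *ᵥ v) := by
        rw [dotProduct_mulVec, vecMul_transpose, mulVec_mulVec, hUU, one_mulVec]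
      rw [this]
      exact Finset.sum_congr rfl fun i _ => by ring
    rw [e1, e2, Finset.mul_sum] at hva
    exact absurd hva (not_lt.2 (Finset.sum_le_sum fun i _ =>
      mul_le_mul_of_nonneg_right (hcon i).le (sq_nonneg _)))
  obtain ⟨i, hi⟩ := hex
  rw [htr]
  refine le_trans ?_ (Finset.single_le_sum (f := fun i => Real.exp (-θ * hH.eigenvalues i))
    (fun i _ => (Real.exp_pos _).le) (Finset.mem_univ i))
  rw [Real.exp_le_exp]
  nlinarith

end RankOne

section Chernoff

variable {𝓧 : Type*}

/-- The unnormalised Gram matrix `∑ᵢ u(xᵢ) u(xᵢ)ᵀ`. -/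
def outerSum {k : ℕ} (u : Fin k → 𝓧 → ℝ) {ι : Type*} [Fintype ι] (x : ι → 𝓧) :
    Matrix (Fin k) (Fin k) ℝ :=
  ∑ i, vecMulVec (feat u (x i)) (feat u (x i))

variable {k : ℕ} {u : Fin k → 𝓧 → ℝ}

theorem outerSum_apply {ι : Type*} [Fintype ι] (x : ι → 𝓧) (a b : Fin k) :
    outerSum u x a b = ∑ i, u a (x i) * u b (x i) := by
  simp [outerSum, Matrix.sum_apply, vecMulVec_apply, feat]

theorem outerSum_isSymm {ι : Type*} [Fintype ι] (x : ι → 𝓧) : (outerSum u x).IsSymm := by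
  ext a b
  simp [outerSum_apply, mul_comm]

theorem dotProduct_outerSum_mulVec {ι : Type*} [Fintype ι] (x : ι → 𝓧) (v : Fin k → ℝ) :
    v ⬝ᵥ (outerSum u x *ᵥ v) = ∑ i, (v ⬝ᵥ feat u (x i)) ^ 2 := by
  simp only [outerSum, sum_mulVec, dotProduct_sum, vecMulVec_mulVec]
  refine Finset.sum_congr rfl fun i _ => ?_
  simp [dotProduct_comm, pow_two]

variable [MeasurableSpace 𝓧]

theorem measurable_continuous_comp_matrix {Z : Type*} [MeasurableSpace Z]
    {F : Z → Matrix (Fin k) (Fin k) ℝ} (hF : ∀ i j, Measurable fun z => F z i j)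
    {g : Matrix (Fin k) (Fin k) ℝ → ℝ} (hg : Continuous g) : Measurable fun z => g (F z) := by
  have h1 : Measurable fun z => (fun i j => F z i j : Fin k → Fin k → ℝ) :=
    measurable_pi_iff.2 fun i => measurable_pi_iff.2 fun j => hF i j
  have h2 : Continuous fun M : Fin k → Fin k → ℝ => g (Matrix.of M) := hg
  exact h2.measurable.comp h1

theorem measurable_outerSum_apply (hu : ∀ j, Measurable (u j)) {ι : Type*} [Fintype ι]
    (a b : Fin k) : Measurable fun x : ι → 𝓧 => outerSum u x a b := by
  simp only [outerSum_apply]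
  exact Finset.measurable_sum _ fun i _ =>
    ((hu a).comp (measurable_pi_apply i)).mul ((hu b).comp (measurable_pi_apply i))

theorem continuous_trace_exp :
    Continuous fun M : Matrix (Fin k) (Fin k) ℝ => (NormedSpace.exp M).trace :=
  continuous_matrix_exp.matrix_trace

variable {ν : Measure 𝓧}

theorem integral_dotProduct_mulVec (hu : ∀ i j, Integrable (fun y => u i y * u j y) ν)
    (horth : IsONB ν u) (P : Matrix (Fin k) (Fin k) ℝ) :
    Integrable (fun y => feat u y ⬝ᵥ (P *ᵥ feat u y)) ν ∧
      ∫ y, feat u y ⬝ᵥ (P *ᵥ feat u y) ∂ν = P.trace := by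
  have e : (fun y => feat u y ⬝ᵥ (P *ᵥ feat u y)) =
      fun y => ∑ i, ∑ j, P i j * (u i y * u j y) := by
    funext y
    simp only [dotProduct, mulVec, feat, Finset.mul_sum]
    exact Finset.sum_congr rfl fun i _ => Finset.sum_congr rfl fun j _ => by ring
  have hint : ∀ i j, Integrable (fun y => P i j * (u i y * u j y)) ν :=
    fun i j => (hu i j).const_mul _
  rw [e]
  refine ⟨integrable_finsetSum _ fun i _ => integrable_finsetSum _ fun j _ => hint i j, ?_⟩
  rw [integral_finsetSum _ fun i _ => integrable_finsetSum _ fun j _ => hint i j]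
  simp_rw [integral_finsetSum _ fun j _ => hint _ j, integral_const_mul, horth _ _]
  simp [Matrix.trace]

variable [IsProbabilityMeasure ν]

theorem lintegral_pi_fin_succ {N : ℕ} {F : (Fin (N + 1) → 𝓧) → ℝ≥0∞} (hF : Measurable F) :
    ∫⁻ z, F z ∂(Measure.pi fun _ => ν) =
      ∫⁻ y, ∫⁻ z : Fin N → 𝓧, F (Fin.cons y z) ∂(Measure.pi fun _ => ν) ∂ν := by
  have hmp := (measurePreserving_piFinSuccAbove (fun _ : Fin (N + 1) => ν) 0).symm
  rw [← hmp.lintegral_comp hF]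
  refine (lintegral_prod _ (hF.comp hmp.measurable).aemeasurable).trans ?_
  simp [MeasurableEquiv.piFinSuccAbove, Fin.consEquiv]

variable [NeZero k]

theorem lintegral_trace_exp_rankOne_le
    (hint : ∀ i j, Integrable (fun y => u i y * u j y) ν) (horth : IsONB ν u) {θ K : ℝ}
    (hK : 0 < K) (hb : ∀ y, feat u y ⬝ᵥ feat u y ≤ K) {Q : Matrix (Fin k) (Fin k) ℝ}
    (hQ : Q.IsSymm) :
    ∫⁻ y, ENNReal.ofReal (NormedSpace.exp
        (Q + (-θ) • vecMulVec (feat u y) (feat u y))).trace ∂ν ≤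
      ENNReal.ofReal (Real.exp (-((1 - Real.exp (-(θ * K))) / K)) * (NormedSpace.exp Q).trace) := by
  set κ := (1 - Real.exp (-(θ * K))) / K
  set P := NormedSpace.exp Q
  obtain ⟨hi, he⟩ := integral_dotProduct_mulVec hint horth P
  have hle : ∀ y, (NormedSpace.exp (Q + (-θ) • vecMulVec (feat u y) (feat u y))).trace ≤
      P.trace - κ * (feat u y ⬝ᵥ (P *ᵥ feat u y)) := fun y =>
    trace_exp_add_rankOne_le hQ hK _ (hb y)
  calc _ ≤ ∫⁻ y, ENNReal.ofReal (P.trace - κ * (feat u y ⬝ᵥ (P *ᵥ feat u y))) ∂ν :=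
        lintegral_mono fun y => ENNReal.ofReal_le_ofReal (hle y)
    _ = ENNReal.ofReal (∫ y, (P.trace - κ * (feat u y ⬝ᵥ (P *ᵥ feat u y))) ∂ν) :=
        (ofReal_integral_eq_lintegral_ofReal ((integrable_const _).sub (hi.const_mul _))
          (.of_forall fun y => (trace_matrix_exp_nonneg
            (hQ.add ((vecMulVec_self_isSymm _).smul _))).trans (hle y))).symm
    _ = ENNReal.ofReal ((1 - κ) * P.trace) := by
        rw [integral_sub (integrable_const _) (hi.const_mul _), integral_const_mul, he]
        simp; congr 1; ring
    _ ≤ _ := ENNReal.ofReal_le_ofReal (mul_le_mul_of_nonneg_right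
        (Real.one_sub_le_exp_neg κ) (trace_matrix_exp_nonneg hQ))

theorem lintegral_trace_exp_outerSum_le (hu : ∀ j, Measurable (u j))
    (hint : ∀ i j, Integrable (fun y => u i y * u j y) ν) (horth : IsONB ν u) {θ K : ℝ}
    (hK : 0 < K) (hb : ∀ y, feat u y ⬝ᵥ feat u y ≤ K) (N : ℕ)
    {Q : Matrix (Fin k) (Fin k) ℝ} (hQ : Q.IsSymm) :
    ∫⁻ z : Fin N → 𝓧, ENNReal.ofReal (NormedSpace.exp (Q + (-θ) • outerSum u z)).trace
        ∂(Measure.pi fun _ => ν) ≤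
      ENNReal.ofReal (Real.exp (-((1 - Real.exp (-(θ * K))) / K)) ^ N *
        (NormedSpace.exp Q).trace) := by
  induction N generalizing Q with
  | zero => simp [outerSum]
  | succ N ih =>
    set c := Real.exp (-((1 - Real.exp (-(θ * K))) / K))
    have hc : 0 ≤ c := (Real.exp_pos _).le
    have hmeas : ∀ n : ℕ, Measurable fun z : Fin n → 𝓧 =>
        ENNReal.ofReal (NormedSpace.exp (Q + (-θ) • outerSum u z)).trace := fun n =>
      (measurable_continuous_comp_matrix (F := fun z : Fin n → 𝓧 => Q + (-θ) • outerSum u z)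
        (fun i j => by
          simpa using ((measurable_outerSum_apply hu i j).const_mul θ).neg.const_add _)
        continuous_trace_exp).ennreal_ofReal
    rw [lintegral_pi_fin_succ (hmeas _)]
    have hsplit : ∀ (y : 𝓧) (z : Fin N → 𝓧),
        Q + (-θ) • outerSum u (Fin.cons y z : Fin (N + 1) → 𝓧) =
          (Q + (-θ) • vecMulVec (feat u y) (feat u y)) + (-θ) • outerSum u z := by
      intro y z
      rw [add_assoc, ← smul_add]
      congr 2
      simp [outerSum, Fin.sum_univ_succ]
    calc _ ≤ ∫⁻ y, ENNReal.ofReal (c ^ N) * ENNReal.ofReal (NormedSpace.exp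
              (Q + (-θ) • vecMulVec (feat u y) (feat u y))).trace ∂ν := by
          refine lintegral_mono fun y => ?_
          simp only [hsplit]
          rw [← ENNReal.ofReal_mul (pow_nonneg hc N)]
          exact ih (hQ.add ((vecMulVec_self_isSymm _).smul _))
      _ = ENNReal.ofReal (c ^ N) * ∫⁻ y, ENNReal.ofReal (NormedSpace.exp
              (Q + (-θ) • vecMulVec (feat u y) (feat u y))).trace ∂ν :=
          lintegral_const_mul' _ _ ENNReal.ofReal_ne_top
      _ ≤ ENNReal.ofReal (c ^ N) * ENNReal.ofReal (c * (NormedSpace.exp Q).trace) := by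
          gcongr
          exact lintegral_trace_exp_rankOne_le hint horth hK hb hQ
      _ = _ := by
          rw [← ENNReal.ofReal_mul (pow_nonneg hc N), pow_succ, mul_assoc]

/-- Matrix Chernoff lower-tail bound for sums of independent bounded isotropic rank-one
matrices. -/
theorem exists_measurableSet_outerSum_lower_tail (hu : ∀ j, Measurable (u j))
    (hint : ∀ i j, Integrable (fun y => u i y * u j y) ν) (horth : IsONB ν u) {K : ℝ}
    (hK : 0 < K) (hb : ∀ y, feat u y ⬝ᵥ feat u y ≤ K) {δ : ℝ} (hδ0 : 0 < δ) (hδ1 : δ < 1) (N : ℕ) :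
    ∃ T : Set (Fin N → 𝓧), MeasurableSet T ∧
      (Measure.pi fun _ => ν) T ≤ ENNReal.ofReal (k * Real.exp (-(cDelta δ * N / K))) ∧
      ∀ z ∉ T, ∀ v : Fin k → ℝ,
        (1 - δ) * N * (v ⬝ᵥ v) ≤ v ⬝ᵥ (outerSum u z *ᵥ v) := by
  set θ : ℝ := -Real.log (1 - δ) / K with hθ
  have hlog : Real.log (1 - δ) ≤ 0 := Real.log_nonpos (by linarith) (by linarith)
  have hθ0 : 0 ≤ θ := div_nonneg (neg_nonneg.2 hlog) hK.le
  have hmeas : Measurable fun z : Fin N → 𝓧 =>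
      ENNReal.ofReal (NormedSpace.exp ((-θ) • outerSum u z)).trace :=
    (measurable_continuous_comp_matrix (F := fun z : Fin N → 𝓧 => (-θ) • outerSum u z)
      (fun i j => by
        simpa using (measurable_outerSum_apply (ι := Fin N) hu i j).const_mul θ)
      continuous_trace_exp).ennreal_ofReal
  set t : ℝ := Real.exp (-(θ * ((1 - δ) * N))) with ht
  have ht0 : 0 < t := Real.exp_pos _
  refine ⟨{z | ENNReal.ofReal t ≤ ENNReal.ofReal (NormedSpace.exp ((-θ) • outerSum u z)).trace},
    measurableSet_le measurable_const hmeas, ?_, ?_⟩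
  · refine (meas_ge_le_lintegral_div hmeas.aemeasurable (by simpa using ht0)
      ENNReal.ofReal_ne_top).trans ?_
    have h1 := lintegral_trace_exp_outerSum_le (θ := θ) hu hint horth hK hb N
      (Q := 0) Matrix.transpose_zero
    simp only [zero_add, NormedSpace.exp_zero, trace_one, Fintype.card_fin] at h1
    refine (ENNReal.div_le_div_right h1 _).trans ?_
    rw [← ENNReal.ofReal_div_of_pos ht0]
    refine ENNReal.ofReal_le_ofReal (le_of_eq ?_)
    have hθK : θ * K = -Real.log (1 - δ) := by rw [hθ]; field_simp
    rw [hθK, neg_neg, Real.exp_log (by linarith), ← Real.exp_nat_mul, ht, mul_comm, mul_div_assoc,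
      ← Real.exp_sub]
    congr 2
    rw [hθ, cDelta]
    field_simp
    ring
  · intro z hz v
    by_contra! hcon
    exact hz (ENNReal.ofReal_le_ofReal (exp_neg_le_trace_exp (outerSum_isSymm z) hθ0 hcon))

end Chernoff

section VolumeSampling

/-- A symmetrised form of the Cauchy-Binet formula for Gram determinants. -/
theorem factorial_mul_det_transpose_mul_self {k : ℕ} {ι : Type*} [Fintype ι]
    (A : Matrix ι (Fin k) ℝ) :
    (k.factorial : ℝ) * (Aᵀ * A).det = ∑ r : Fin k → ι, (A.submatrix r id).det ^ 2 := by
  classical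
  have h1 : (Aᵀ * A).det = ∑ r : Fin k → ι, (∏ j, A (r j) j) * (A.submatrix r id).det := by
    have e : (Aᵀ * A) = fun j => ∑ i, A i j • A i := by
      ext j l; simp [Matrix.mul_apply]
    rw [e]
    have := (Matrix.detRowAlternating (n := Fin k) (R := ℝ)).toMultilinearMap.map_sum
      (fun j i => A i j • A i)
    refine this.trans (Finset.sum_congr rfl fun r _ => ?_)
    have h2 := (Matrix.detRowAlternating (n := Fin k) (R := ℝ)).toMultilinearMap.map_smul_univ
      (fun j => A (r j) j) (fun j => A (r j))
    exact h2
  have h2 : ∀ r : Fin k → ι, (A.submatrix r id).det ^ 2 =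
      ∑ σ : Equiv.Perm (Fin k), (∏ j, A (r (σ j)) j) * (A.submatrix (r ∘ σ) id).det := by
    intro r
    rw [pow_two]
    conv_lhs => enter [1]; rw [det_apply']
    rw [Finset.sum_mul]
    refine Finset.sum_congr rfl fun σ _ => ?_
    have : (A.submatrix (r ∘ σ) id).det = Equiv.Perm.sign σ * (A.submatrix r id).det := by
      rw [← det_permute]; rfl
    rw [this]
    simp only [submatrix_apply, id]
    ring
  simp_rw [h2]
  rw [Finset.sum_comm]
  have h3 : ∀ σ : Equiv.Perm (Fin k),
      ∑ r : Fin k → ι, (∏ j, A (r (σ j)) j) * (A.submatrix (r ∘ σ) id).det = (Aᵀ * A).det := by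
    intro σ
    rw [h1]
    exact (Equiv.arrowCongr σ.symm (Equiv.refl ι)).sum_comp
      (fun r : Fin k → ι => (∏ j, A (r j) j) * (A.submatrix r id).det)
  simp [h3, Fintype.card_perm]

theorem factorial_mul_det_transpose_mul_self_eq_sum_embedding {k : ℕ} {ι : Type*} [Fintype ι]
    (A : Matrix ι (Fin k) ℝ) :
    (k.factorial : ℝ) * (Aᵀ * A).det = ∑ r : Fin k ↪ ι, (A.submatrix r id).det ^ 2 := by
  classical
  rw [factorial_mul_det_transpose_mul_self]
  refine (Fintype.sum_of_injective (fun r : Fin k ↪ ι => (r : Fin k → ι)) DFunLike.coe_injective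
    _ _ (fun r hr => ?_) fun r => rfl).symm
  have hinj : ¬ Function.Injective r := fun h => hr ⟨⟨r, h⟩, rfl⟩
  simp only [Function.Injective, not_forall] at hinj
  obtain ⟨i, j, hij, hne⟩ := hinj
  rw [det_zero_of_row_eq hne (by ext l; simp [hij]), zero_pow two_ne_zero]

theorem exists_sum_equiv_extending {k N n : ℕ} (hn : k + N = n) (r : Fin k ↪ Fin n) :
    ∃ e : Fin k ⊕ Fin N ≃ Fin n, ∀ i, e (Sum.inl i) = r i := by
  classical
  have hc : Fintype.card (Fin N) = Fintype.card ((Set.range r)ᶜ : Set (Fin n)) := by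
    rw [Fintype.card_compl_set, Set.card_range_of_injective r.injective]
    simp; omega
  refine ⟨((Equiv.ofInjective r r.injective).sumCongr (Fintype.equivOfCardEq hc)).trans
    (Equiv.Set.sumCompl (Set.range r)), fun i => ?_⟩
  simp

variable {𝓧 : Type*}

theorem factorial_mul_det_outerSum {k : ℕ} (u : Fin k → 𝓧 → ℝ) {ι : Type*} [Fintype ι]
    (x : ι → 𝓧) :
    (k.factorial : ℝ) * (outerSum u x).det =
      ∑ r : Fin k ↪ ι, (Matrix.of fun j i => u j (x (r i))).det ^ 2 := by
  have e : outerSum u x = (Matrix.of fun i j => u j (x i))ᵀ * (Matrix.of fun i j => u j (x i)) := by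
    ext a b; simp [outerSum_apply, Matrix.mul_apply]
  rw [e, factorial_mul_det_transpose_mul_self_eq_sum_embedding]
  refine Finset.sum_congr rfl fun r _ => ?_
  rw [← det_transpose]; rfl

theorem det_outerSum_nonneg {k : ℕ} (u : Fin k → 𝓧 → ℝ) {ι : Type*} [Fintype ι]
    (x : ι → 𝓧) : 0 ≤ (outerSum u x).det := by
  have h := factorial_mul_det_outerSum u x
  have h2 : 0 ≤ (k.factorial : ℝ) * (outerSum u x).det :=
    h ▸ Finset.sum_nonneg fun r _ => sq_nonneg _
  exact nonneg_of_mul_nonneg_right h2 (by positivity)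

theorem factorial_mul_ofReal_det_outerSum {k : ℕ} (u : Fin k → 𝓧 → ℝ) {ι : Type*} [Fintype ι]
    (x : ι → 𝓧) :
    (k.factorial : ℝ≥0∞) * ENNReal.ofReal (outerSum u x).det =
      ∑ r : Fin k ↪ ι, ENNReal.ofReal ((Matrix.of fun j i => u j (x (r i))).det ^ 2) := by
  rw [← ENNReal.ofReal_sum_of_nonneg fun r _ => sq_nonneg _, ← factorial_mul_det_outerSum,
    ENNReal.ofReal_mul (by positivity), ENNReal.ofReal_natCast]

variable [MeasurableSpace 𝓧] {ν : Measure 𝓧} [IsProbabilityMeasure ν]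

theorem lintegral_mul_split {k N n : ℕ} (e : Fin k ⊕ Fin N ≃ Fin n)
    {F : (Fin k → 𝓧) → ℝ≥0∞} {G : (Fin N → 𝓧) → ℝ≥0∞} (hF : Measurable F) (hG : Measurable G) :
    ∫⁻ x : Fin n → 𝓧, F (fun i => x (e (Sum.inl i))) * G (fun i => x (e (Sum.inr i)))
        ∂(Measure.pi fun _ => ν) =
      (∫⁻ y, F y ∂(Measure.pi fun _ => ν)) * ∫⁻ z, G z ∂(Measure.pi fun _ => ν) := by
  have h1 := (measurePreserving_piCongrLeft (fun _ : Fin n => ν) e).symm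
  have h2 := measurePreserving_sumPiEquivProdPi (fun _ : Fin k ⊕ Fin N => ν)
  have h3 := h2.comp h1
  rw [← lintegral_prod_mul hF.aemeasurable hG.aemeasurable]
  refine Eq.trans ?_ (h3.lintegral_comp (f := fun p => F p.1 * G p.2)
    ((hF.comp measurable_fst).mul (hG.comp measurable_snd)))
  rfl

theorem lintegral_sq_det_eq_factorial {k : ℕ} {u : Fin k → 𝓧 → ℝ}
    (hint : ∀ i j, Integrable (fun y => u i y * u j y) ν) (horth : IsONB ν u) :
    ∫⁻ y : Fin k → 𝓧, ENNReal.ofReal ((Matrix.of fun j i => u j (y i)).det ^ 2)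
      ∂(Measure.pi fun _ => ν) = k.factorial := by
  classical
  have e : ∀ y : Fin k → 𝓧, (Matrix.of fun j i => u j (y i)).det ^ 2 =
      ∑ σ : Equiv.Perm (Fin k), ∑ τ : Equiv.Perm (Fin k),
        ((Equiv.Perm.sign σ : ℤ) : ℝ) * ((Equiv.Perm.sign τ : ℤ) : ℝ) *
          ∏ i, u (σ i) (y i) * u (τ i) (y i) := by
    intro y
    rw [pow_two, det_apply', Finset.sum_mul_sum]
    refine Finset.sum_congr rfl fun σ _ => Finset.sum_congr rfl fun τ _ => ?_
    rw [Finset.prod_mul_distrib]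
    simp only [of_apply]
    ring
  have hi : ∀ σ τ : Equiv.Perm (Fin k), Integrable (fun y : Fin k → 𝓧 =>
      ((Equiv.Perm.sign σ : ℤ) : ℝ) * ((Equiv.Perm.sign τ : ℤ) : ℝ) *
          ∏ i, u (σ i) (y i) * u (τ i) (y i)) (Measure.pi fun _ => ν) := fun σ τ =>
    (Integrable.fintype_prod (f := fun i y => u (σ i) y * u (τ i) y)
      fun i => hint _ _).const_mul _
  have hI : ∀ σ τ : Equiv.Perm (Fin k), ∫ y : Fin k → 𝓧,
      ((Equiv.Perm.sign σ : ℤ) : ℝ) * ((Equiv.Perm.sign τ : ℤ) : ℝ) *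
          ∏ i, u (σ i) (y i) * u (τ i) (y i) ∂(Measure.pi fun _ => ν) =
      if σ = τ then 1 else 0 := by
    intro σ τ
    rw [integral_const_mul, integral_fintype_prod_eq_prod (fun i y => u (σ i) y * u (τ i) y)]
    simp_rw [horth _ _]
    split_ifs with h
    · subst h
      rw [← Int.cast_mul, Int.units_coe_mul_self]
      simp
    · obtain ⟨i, hi⟩ : ∃ i, σ i ≠ τ i := by
        by_contra! hc
        exact h (Equiv.ext hc)
      rw [Finset.prod_eq_zero (Finset.mem_univ i) (if_neg hi), mul_zero]
  rw [← ofReal_integral_eq_lintegral_ofReal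
    (by
      simp_rw [e]
      exact integrable_finsetSum _ fun σ _ => integrable_finsetSum _ fun τ _ => hi σ τ)
    (.of_forall fun y => sq_nonneg _)]
  simp_rw [e]
  rw [integral_finsetSum _ fun σ _ => integrable_finsetSum _ fun τ _ => hi σ τ]
  simp_rw [integral_finsetSum _ fun τ _ => hi _ τ, hI]
  simp [Fintype.card_perm]

theorem measurable_det_features {k : ℕ} {u : Fin k → 𝓧 → ℝ} (hu : ∀ j, Measurable (u j))
    {ι : Type*} (r : Fin k → ι) : Measurable fun x : ι → 𝓧 =>
      ENNReal.ofReal ((Matrix.of fun j i => u j (x (r i))).det ^ 2) := by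
  refine Measurable.ennreal_ofReal (Measurable.pow_const ?_ 2)
  exact measurable_continuous_comp_matrix
    (F := fun x : ι → 𝓧 => Matrix.of fun j i => u j (x (r i)))
    (fun i j => (hu i).comp (measurable_pi_apply _)) (continuous_id.matrix_det)

/-- Volume-sampling mass of an event all of whose elements have every sub-configuration of `N`
points in a given event. -/
theorem lintegral_det_outerSum_indicator_le {k N n : ℕ} (hn : k + N = n) {u : Fin k → 𝓧 → ℝ}
    (hu : ∀ j, Measurable (u j)) (hint : ∀ i j, Integrable (fun y => u i y * u j y) ν)
    (horth : IsONB ν u) {T : Set (Fin n → 𝓧)} {T' : Set (Fin N → 𝓧)} (hT : MeasurableSet T)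
    (hT' : MeasurableSet T') (h : ∀ x ∈ T, ∀ e : Fin k ⊕ Fin N ≃ Fin n,
      (fun i => x (e (Sum.inr i))) ∈ T') :
    ∫⁻ x, ENNReal.ofReal (outerSum u x).det * T.indicator 1 x ∂(Measure.pi fun _ => ν) ≤
      n.descFactorial k * (Measure.pi fun _ => ν) T' := by
  have hk0 : (k.factorial : ℝ≥0∞) ≠ 0 := by exact_mod_cast k.factorial_ne_zero
  have hk1 : (k.factorial : ℝ≥0∞) ≠ ∞ := ENNReal.natCast_ne_top _
  rw [← ENNReal.mul_le_mul_iff_right hk0 hk1, ← lintegral_const_mul' _ _ hk1]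
  simp_rw [← mul_assoc, factorial_mul_ofReal_det_outerSum, Finset.sum_mul]
  refine (lintegral_finsetSum Finset.univ (f := fun (r : Fin k ↪ Fin n) (x : Fin n → 𝓧) =>
    ENNReal.ofReal ((Matrix.of fun j i => u j (x (r i))).det ^ 2) * T.indicator 1 x) fun r _ =>
    (measurable_det_features hu r).mul (measurable_one.indicator hT)).trans_le ?_
  have hr : ∀ r : Fin k ↪ Fin n,
      ∫⁻ x : Fin n → 𝓧, ENNReal.ofReal ((Matrix.of fun j i => u j (x (r i))).det ^ 2) *
        T.indicator 1 x ∂(Measure.pi fun _ => ν) ≤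
      k.factorial * (Measure.pi fun _ => ν) T' := by
    intro r
    obtain ⟨e, he⟩ := exists_sum_equiv_extending hn r
    have hs := lintegral_mul_split (ν := ν) e (measurable_det_features hu id)
      ((measurable_one : Measurable (1 : (Fin N → 𝓧) → ℝ≥0∞)).indicator hT')
    simp only [id, lintegral_sq_det_eq_factorial hint horth, lintegral_indicator_one hT'] at hs
    rw [← hs]
    refine lintegral_mono fun x => ?_
    simp only [he]
    gcongr
    by_cases hx : x ∈ T
    · simp [hx, h x hx e]
    · simp [hx]
  refine (Finset.sum_le_sum fun r _ => hr r).trans (le_of_eq ?_)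
  rw [Finset.sum_const, nsmul_eq_mul, Finset.card_univ, Fintype.card_embedding_eq]
  simp only [Fintype.card_fin]
  ring

theorem lintegral_det_outerSum {k n : ℕ} (hn : k ≤ n) {u : Fin k → 𝓧 → ℝ}
    (hu : ∀ j, Measurable (u j)) (hint : ∀ i j, Integrable (fun y => u i y * u j y) ν)
    (horth : IsONB ν u) :
    ∫⁻ x : Fin n → 𝓧, ENNReal.ofReal (outerSum u x).det ∂(Measure.pi fun _ => ν) =
      n.descFactorial k := by
  have hk0 : (k.factorial : ℝ≥0∞) ≠ 0 := by exact_mod_cast k.factorial_ne_zero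
  have hk1 : (k.factorial : ℝ≥0∞) ≠ ∞ := ENNReal.natCast_ne_top _
  rw [← ENNReal.mul_right_inj hk0 hk1, ← lintegral_const_mul' _ _ hk1]
  simp_rw [factorial_mul_ofReal_det_outerSum]
  refine (lintegral_finsetSum Finset.univ (f := fun (r : Fin k ↪ Fin n) (x : Fin n → 𝓧) =>
    ENNReal.ofReal ((Matrix.of fun j i => u j (x (r i))).det ^ 2)) fun r _ =>
    measurable_det_features hu r).trans ?_
  have hr : ∀ r : Fin k ↪ Fin n,
      ∫⁻ x : Fin n → 𝓧, ENNReal.ofReal ((Matrix.of fun j i => u j (x (r i))).det ^ 2)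
        ∂(Measure.pi fun _ => ν) = k.factorial := by
    intro r
    obtain ⟨e, he⟩ := exists_sum_equiv_extending (Nat.add_sub_cancel' hn) r
    have hs := lintegral_mul_split (ν := ν) e (measurable_det_features hu id)
      (measurable_const (a := (1 : ℝ≥0∞)))
    simpa [he, lintegral_sq_det_eq_factorial hint horth] using hs
  rw [Finset.sum_congr rfl fun r _ => hr r, Finset.sum_const, nsmul_eq_mul, Finset.card_univ,
    Fintype.card_embedding_eq]
  simp only [Fintype.card_fin]
  ring

end VolumeSampling

section LeastSquares

variable {𝓧 : Type*} {k : ℕ} {u : Fin k → 𝓧 → ℝ} {ι : Type*} [Fintype ι]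

theorem dotProduct_outerSum_mulVec_comm (x : ι → 𝓧) (v c : Fin k → ℝ) :
    v ⬝ᵥ (outerSum u x *ᵥ c) = ∑ i, (v ⬝ᵥ feat u (x i)) * (c ⬝ᵥ feat u (x i)) := by
  simp only [outerSum, sum_mulVec, dotProduct_sum, vecMulVec_mulVec]
  refine Finset.sum_congr rfl fun i _ => ?_
  simp [dotProduct_comm, mul_comm]

theorem outerSum_subconfiguration_le {κ : Type*} [Fintype κ] {g : κ → ι}
    (hg : Function.Injective g) (x : ι → 𝓧) (v : Fin k → ℝ) :
    v ⬝ᵥ (outerSum u (fun i => x (g i)) *ᵥ v) ≤ v ⬝ᵥ (outerSum u x *ᵥ v) := by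
  classical
  rw [dotProduct_outerSum_mulVec, dotProduct_outerSum_mulVec,
    ← Finset.sum_image (s := Finset.univ) (g := g) (f := fun i => (v ⬝ᵥ feat u (x i)) ^ 2)
      hg.injOn]
  exact Finset.sum_le_sum_of_subset_of_nonneg (Finset.subset_univ _) fun i _ _ => sq_nonneg _

theorem isUnit_det_of_dotProduct_lower {S : Matrix (Fin k) (Fin k) ℝ} {c : ℝ} (hc : 0 < c)
    (h : ∀ v, c * (v ⬝ᵥ v) ≤ v ⬝ᵥ (S *ᵥ v)) : IsUnit S.det := by
  rw [isUnit_iff_ne_zero]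
  intro h0
  obtain ⟨v, hv, hS⟩ := exists_mulVec_eq_zero_iff.2 h0
  have h1 := h v
  rw [hS, dotProduct_zero] at h1
  have h2 : 0 < v ⬝ᵥ v := by
    refine lt_of_le_of_ne (Finset.sum_nonneg fun i _ => mul_self_nonneg _) fun h3 => hv ?_
    exact dotProduct_self_eq_zero.1 h3.symm
  nlinarith

theorem normalEquations_energy_le (x : ι → 𝓧) (r : ι → ℝ) {c : Fin k → ℝ}
    (hc : outerSum u x *ᵥ c = ∑ i, r i • feat u (x i)) :
    c ⬝ᵥ (outerSum u x *ᵥ c) ≤ ∑ i, r i ^ 2 := by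
  have h1 : c ⬝ᵥ (outerSum u x *ᵥ c) = ∑ i, r i * (c ⬝ᵥ feat u (x i)) := by
    rw [hc, dotProduct_sum]
    simp
  have h2 := dotProduct_outerSum_mulVec (u := u) x c
  have h3 : 0 ≤ ∑ i, (r i - c ⬝ᵥ feat u (x i)) ^ 2 := Finset.sum_nonneg fun i _ => sq_nonneg _
  have h4 : ∑ i, (r i - c ⬝ᵥ feat u (x i)) ^ 2 =
      ∑ i, r i ^ 2 - 2 * ∑ i, r i * (c ⬝ᵥ feat u (x i)) + ∑ i, (c ⬝ᵥ feat u (x i)) ^ 2 := by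
    rw [Finset.mul_sum, ← Finset.sum_sub_distrib, ← Finset.sum_add_distrib]
    exact Finset.sum_congr rfl fun i _ => by ring
  linarith

theorem det_mul_sq_le_adjugate_mul (x : ι → 𝓧) (hdet : 0 < (outerSum u x).det)
    (c : Fin k → ℝ) (j : Fin k) :
    (outerSum u x).det * c j ^ 2 ≤
      (outerSum u x).adjugate j j * (c ⬝ᵥ (outerSum u x *ᵥ c)) := by
  set S := outerSum u x with hS
  have hST : Sᵀ = S := outerSum_isSymm x
  set d : Fin k → ℝ := S.adjugate *ᵥ Pi.single j 1 with hd
  have hSd : S *ᵥ d = S.det • Pi.single j 1 := by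
    rw [hd, mulVec_mulVec, mul_adjugate, smul_mulVec, one_mulVec]
  have h1 : d ⬝ᵥ (S *ᵥ c) = S.det * c j := by
    rw [dotProduct_mulVec, ← mulVec_transpose, hST, hSd]
    simp
  have h2 : d ⬝ᵥ (S *ᵥ d) = S.det * S.adjugate j j := by
    rw [hSd, hd]
    simp
  have h3 : (d ⬝ᵥ (S *ᵥ c)) ^ 2 ≤ (d ⬝ᵥ (S *ᵥ d)) * (c ⬝ᵥ (S *ᵥ c)) := by
    rw [hS, dotProduct_outerSum_mulVec_comm, dotProduct_outerSum_mulVec,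
      dotProduct_outerSum_mulVec]
    exact Finset.sum_mul_sq_le_sq_mul_sq _ _ _
  rw [h1, h2] at h3
  refine le_of_mul_le_mul_left ?_ hdet
  nlinarith

theorem adjugate_outerSum_diag {u : Fin (k + 1) → 𝓧 → ℝ} (x : ι → 𝓧) (j : Fin (k + 1)) :
    (outerSum u x).adjugate j j = (outerSum (fun i => u (j.succAbove i)) x).det := by
  rw [adjugate_fin_succ_eq_det_submatrix, ← two_mul, pow_mul, neg_one_sq, one_pow, one_mul]
  congr 1
  ext a b
  simp [outerSum_apply]

variable [MeasurableSpace 𝓧]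

theorem measurableSet_outerSum_lower (hu : ∀ j, Measurable (u j)) (c : ℝ) :
    MeasurableSet {x : ι → 𝓧 | ∀ v, c * (v ⬝ᵥ v) ≤ v ⬝ᵥ (outerSum u x *ᵥ v)} := by
  have h1 : Measurable fun x : ι → 𝓧 => (fun i j => outerSum u x i j : Fin k → Fin k → ℝ) :=
    measurable_pi_iff.2 fun i => measurable_pi_iff.2 fun j => measurable_outerSum_apply hu i j
  have h2 : IsClosed {M : Fin k → Fin k → ℝ |
      ∀ v : Fin k → ℝ, c * (v ⬝ᵥ v) ≤ v ⬝ᵥ (Matrix.of M *ᵥ v)} := by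
    simp only [Set.ofPred_forall]
    refine isClosed_iInter fun v => isClosed_le continuous_const ?_
    simp only [dotProduct, mulVec, Matrix.of_apply]
    fun_prop
  exact h1 h2.measurableSet

variable {ν : Measure 𝓧} [IsProbabilityMeasure ν]

/-- Mass under volume sampling with a subfamily of the features of the event that the full Gram
matrix is badly conditioned. -/
theorem lintegral_det_outerSum_lower_tail_le [NeZero k] {l N n : ℕ} (hn : l + N = n)
    (hu : ∀ j, Measurable (u j)) (hint : ∀ i j, Integrable (fun y => u i y * u j y) ν)
    (horth : IsONB ν u) {K : ℝ} (hK : 0 < K) (hb : ∀ y, feat u y ⬝ᵥ feat u y ≤ K)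
    {δ : ℝ} (hδ0 : 0 < δ) (hδ1 : δ < 1) {M : ℝ} (hM : M ≤ N) (ρ : Fin l ↪ Fin k) :
    ∫⁻ x : Fin n → 𝓧, ENNReal.ofReal (outerSum (fun i => u (ρ i)) x).det *
        {x | ∀ v, (1 - δ) * M * (v ⬝ᵥ v) ≤ v ⬝ᵥ (outerSum u x *ᵥ v)}ᶜ.indicator 1 x
        ∂(Measure.pi fun _ => ν) ≤
      n.descFactorial l * ENNReal.ofReal (k * Real.exp (-(cDelta δ * N / K))) := by
  obtain ⟨T, hT, hνT, h⟩ := exists_measurableSet_outerSum_lower_tail hu hint horth hK hb hδ0 hδ1 N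
  refine (lintegral_det_outerSum_indicator_le hn (fun j => hu (ρ j)) (fun i j => hint _ _) ?_
    (measurableSet_outerSum_lower hu _).compl hT ?_).trans (by gcongr)
  · intro i j
    rw [horth]
    simp
  · intro x hx e
    by_contra hz
    refine hx fun v => ?_
    have h0 : 0 ≤ v ⬝ᵥ v := Finset.sum_nonneg fun i _ => mul_self_nonneg _
    have h1 : (0 : ℝ) ≤ 1 - δ := by linarith
    calc (1 - δ) * M * (v ⬝ᵥ v) ≤ (1 - δ) * N * (v ⬝ᵥ v) := by gcongr
      _ ≤ _ := h _ hz v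
      _ ≤ _ := outerSum_subconfiguration_le (g := fun i => e (Sum.inr i))
        (e.injective.comp Sum.inr_injective) x v

end LeastSquares

section Features

variable {𝓧 : Type*} {m n : ℕ} {φ : Fin m → 𝓧 → ℝ} {w : 𝓧 → ℝ}

theorem lin_eq_dotProduct (a : Fin m → ℝ) (y : 𝓧) : lin φ a y = a ⬝ᵥ feat φ y := rfl

/-- The features rescaled by `w^{-1/2}`. -/
def wfeat (φ : Fin m → 𝓧 → ℝ) (w : 𝓧 → ℝ) : Fin m → 𝓧 → ℝ :=
  fun j y => (Real.sqrt (w y))⁻¹ * φ j y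

theorem wfeat_mul_wfeat (hw : ∀ y, 0 < w y) (i j : Fin m) (y : 𝓧) :
    wfeat φ w i y * wfeat φ w j y = (w y)⁻¹ * (φ i y * φ j y) := by
  have h : (w y)⁻¹ = (Real.sqrt (w y))⁻¹ * (Real.sqrt (w y))⁻¹ := by
    rw [← mul_inv, Real.mul_self_sqrt (hw y).le]
  rw [h, wfeat, wfeat]
  ring

theorem gram_eq_outerSum (hw : ∀ y, 0 < w y) (x : Fin n → 𝓧) :
    gram φ w x = (n : ℝ)⁻¹ • outerSum (wfeat φ w) x := by
  rw [gram]
  congr 1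
  ext a b
  simp [outerSum_apply, wfeat_mul_wfeat hw, Matrix.sum_apply, vecMulVec_apply, feat]

theorem bVec_eq_sum_wfeat (hw : ∀ y, 0 < w y) (g : 𝓧 → ℝ) (x : Fin n → 𝓧) :
    bVec φ w g x =
      (n : ℝ)⁻¹ • ∑ i, ((Real.sqrt (w (x i)))⁻¹ * g (x i)) • feat (wfeat φ w) (x i) := by
  rw [bVec]
  congr 1
  refine Finset.sum_congr rfl fun i _ => ?_
  ext j
  have h : (w (x i))⁻¹ = (Real.sqrt (w (x i)))⁻¹ * (Real.sqrt (w (x i)))⁻¹ := by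
    rw [← mul_inv, Real.mul_self_sqrt (hw _).le]
  simp only [Pi.smul_apply, smul_eq_mul, feat, wfeat, h]
  ring

theorem lsProj_eq_of_isUnit (hw : ∀ y, 0 < w y) (hn : 0 < n) (g : 𝓧 → ℝ) (a : Fin m → ℝ)
    {x : Fin n → 𝓧} (hdet : IsUnit (outerSum (wfeat φ w) x).det) :
    ∃ c : Fin m → ℝ, outerSum (wfeat φ w) x *ᵥ c =
        ∑ i, ((Real.sqrt (w (x i)))⁻¹ * (g (x i) - lin φ a (x i))) • feat (wfeat φ w) (x i) ∧
      lsProj φ w g x = lin φ (fun j => a j + c j) := by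
  set S := outerSum (wfeat φ w) x with hS
  have hn' : (n : ℝ) ≠ 0 := by exact_mod_cast hn.ne'
  have hG : (gram φ w x)⁻¹ *ᵥ bVec φ w g x =
      S⁻¹ *ᵥ ∑ i, ((Real.sqrt (w (x i)))⁻¹ * g (x i)) • feat (wfeat φ w) (x i) := by
    have h1 : (gram φ w x)⁻¹ = (n : ℝ) • S⁻¹ := by
      refine inv_eq_left_inv ?_
      rw [gram_eq_outerSum hw, smul_mul_assoc, mul_smul_comm, smul_smul, mul_inv_cancel₀ hn', one_smul,
        nonsing_inv_mul _ hdet]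
    rw [h1, bVec_eq_sum_wfeat hw, smul_mulVec, mulVec_smul, smul_smul, mul_inv_cancel₀ hn',
      one_smul]
  have hSa : S *ᵥ a =
      ∑ i, ((Real.sqrt (w (x i)))⁻¹ * lin φ a (x i)) • feat (wfeat φ w) (x i) := by
    simp only [hS, outerSum, sum_mulVec, vecMulVec_mulVec]
    refine Finset.sum_congr rfl fun i _ => ?_
    rw [lin_eq_dotProduct, dotProduct_comm, ← smul_eq_mul, ← dotProduct_smul]
    ext j
    simp [feat, wfeat, dotProduct, mul_comm]
  refine ⟨S⁻¹ *ᵥ (∑ i, ((Real.sqrt (w (x i)))⁻¹ * (g (x i) - lin φ a (x i))) •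
    feat (wfeat φ w) (x i)), ?_, ?_⟩
  · rw [mulVec_mulVec, mul_nonsing_inv _ hdet, one_mulVec]
  · rw [lsProj, hG]
    congr 1
    have h2 : a = S⁻¹ *ᵥ (S *ᵥ a) := by
      rw [mulVec_mulVec, nonsing_inv_mul _ hdet, one_mulVec]
    have h3 : S⁻¹ *ᵥ (∑ i, ((Real.sqrt (w (x i)))⁻¹ * g (x i)) • feat (wfeat φ w) (x i)) =
        a + S⁻¹ *ᵥ (∑ i, ((Real.sqrt (w (x i)))⁻¹ * (g (x i) - lin φ a (x i))) •
          feat (wfeat φ w) (x i)) := by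
      nth_rw 1 [h2]
      rw [← mulVec_add, hSa, ← Finset.sum_add_distrib]
      congr 1
      refine Finset.sum_congr rfl fun i _ => ?_
      rw [← add_smul]
      congr 1
      ring
    exact h3

variable [MeasurableSpace 𝓧] {μ : Measure 𝓧}

theorem IsONB.memLp (horth : IsONB μ φ) (hφ : ∀ j, Measurable (φ j)) (j : Fin m) :
    MemLp (φ j) 2 μ := by
  rw [memLp_two_iff_integrable_sq (hφ j).aestronglyMeasurable]
  by_contra h
  have h1 := horth j j
  simp only [← pow_two, if_pos] at h1
  rw [integral_undef h] at h1
  exact zero_ne_one h1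

theorem IsONB.integrable_mul (horth : IsONB μ φ) (hφ : ∀ j, Measurable (φ j)) (i j : Fin m) :
    Integrable (fun y => φ i y * φ j y) μ :=
  (horth.memLp hφ i).integrable_mul (horth.memLp hφ j)

theorem measurable_lin (hφ : ∀ j, Measurable (φ j)) (a : Fin m → ℝ) : Measurable (lin φ a) := by
  unfold lin
  fun_prop

theorem memLp_lin (horth : IsONB μ φ) (hφ : ∀ j, Measurable (φ j)) (a : Fin m → ℝ) :
    MemLp (lin φ a) 2 μ :=
  memLp_finsetSum _ fun j _ => (horth.memLp hφ j).const_mul (a j)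

theorem l2Sq_lin (horth : IsONB μ φ) (hφ : ∀ j, Measurable (φ j)) (a : Fin m → ℝ) :
    l2Sq μ (lin φ a) = a ⬝ᵥ a := by
  have h := (integral_dotProduct_mulVec (horth.integrable_mul hφ) horth (vecMulVec a a)).2
  rw [trace_vecMulVec] at h
  rw [← h, l2Sq]
  congr 1
  funext y
  rw [vecMulVec_mulVec, lin_eq_dotProduct]
  simp [dotProduct_comm, pow_two]

theorem l2_eq_eLpNorm {g : 𝓧 → ℝ} (hg : MemLp g 2 μ) : l2 μ g = (eLpNorm g 2 μ).toReal := by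
  rw [hg.eLpNorm_eq_integral_rpow_norm two_ne_zero ENNReal.ofNat_ne_top,
    ENNReal.toReal_ofReal (by positivity), l2, l2Sq, Real.sqrt_eq_rpow]
  simp

theorem l2_sub_le {g g' : 𝓧 → ℝ} (hg : MemLp g 2 μ) (hg' : MemLp g' 2 μ) :
    l2 μ (fun y => g y - g' y) ≤ l2 μ g + l2 μ g' := by
  have h := eLpNorm_sub_le hg.1 hg'.1 (p := 2) (by norm_num)
  rw [show (fun y => g y - g' y) = g - g' from rfl, l2_eq_eLpNorm (hg.sub hg'), l2_eq_eLpNorm hg,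
    l2_eq_eLpNorm hg', ← ENNReal.toReal_add hg.2.ne hg'.2.ne]
  exact ENNReal.toReal_mono (ENNReal.add_ne_top.2 ⟨hg.2.ne, hg'.2.ne⟩) h

theorem l2Sq_nonneg (g : 𝓧 → ℝ) : 0 ≤ l2Sq μ g := integral_nonneg fun _ => sq_nonneg _

theorem l2_nonneg (g : 𝓧 → ℝ) : 0 ≤ l2 μ g := Real.sqrt_nonneg _

theorem l2_sq (g : 𝓧 → ℝ) : l2 μ g ^ 2 = l2Sq μ g := Real.sq_sqrt (l2Sq_nonneg g)

theorem measurable_wfeat (hφ : ∀ j, Measurable (φ j)) (hwm : Measurable w) (j : Fin m) :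
    Measurable (wfeat φ w j) := by
  unfold wfeat
  fun_prop

theorem dens_eq_nnreal : dens μ w = μ.withDensity fun y => ((w y).toNNReal : ℝ≥0∞) := rfl

theorem integral_dens (hw : ∀ y, 0 < w y) (hwm : Measurable w) (g : 𝓧 → ℝ) :
    ∫ y, (w y)⁻¹ * g y ∂(dens μ w) = ∫ y, g y ∂μ := by
  rw [dens_eq_nnreal, integral_withDensity_eq_integral_smul hwm.real_toNNReal]
  congr 1
  funext y
  rw [NNReal.smul_def, Real.coe_toNNReal _ (hw y).le, smul_eq_mul,
    mul_inv_cancel_left₀ (hw y).ne']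

theorem integrable_dens (hw : ∀ y, 0 < w y) (hwm : Measurable w) {g : 𝓧 → ℝ}
    (hg : Integrable g μ) : Integrable (fun y => (w y)⁻¹ * g y) (dens μ w) := by
  rw [dens_eq_nnreal, integrable_withDensity_iff_integrable_smul hwm.real_toNNReal]
  refine hg.congr (.of_forall fun y => ?_)
  simp only
  rw [NNReal.smul_def, Real.coe_toNNReal _ (hw y).le, smul_eq_mul,
    mul_inv_cancel_left₀ (hw y).ne']

theorem isONB_wfeat (horth : IsONB μ φ) (hw : ∀ y, 0 < w y) (hwm : Measurable w) :
    IsONB (dens μ w) (wfeat φ w) := by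
  intro i j
  simp_rw [wfeat_mul_wfeat hw]
  rw [integral_dens hw hwm (fun y => φ i y * φ j y), horth]

theorem integrable_wfeat_mul (horth : IsONB μ φ) (hφ : ∀ j, Measurable (φ j))
    (hw : ∀ y, 0 < w y) (hwm : Measurable w) (i j : Fin m) :
    Integrable (fun y => wfeat φ w i y * wfeat φ w j y) (dens μ w) := by
  simp_rw [wfeat_mul_wfeat hw]
  exact integrable_dens hw hwm (horth.integrable_mul hφ i j)

theorem isProbabilityMeasure_dens (hw : ∀ y, 0 < w y) (hint : ∫ y, w y ∂μ = 1) :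
    IsProbabilityMeasure (dens μ w) := by
  refine ⟨?_⟩
  have hi : Integrable w μ := by
    by_contra h
    rw [integral_undef h] at hint
    exact zero_ne_one hint
  rw [dens, withDensity_apply _ .univ, setLIntegral_univ,
    ← ofReal_integral_eq_lintegral_ofReal hi (.of_forall fun y => (hw y).le), hint,
    ENNReal.ofReal_one]

theorem vs_eq_withDensity_det_outerSum (hw : ∀ y, 0 < w y) (hmn : m ≤ n) (hn : 0 < n) :
    vs μ φ w n = (Measure.pi fun _ : Fin n => dens μ w).withDensity fun x =>
      (n.descFactorial m : ℝ≥0∞)⁻¹ * ENNReal.ofReal (outerSum (wfeat φ w) x).det := by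
  rw [vs]
  congr 1
  funext x
  have hd : (0 : ℝ) < n.descFactorial m := by exact_mod_cast Nat.descFactorial_pos.2 hmn
  have hn' : (n : ℝ) ≠ 0 := by exact_mod_cast hn.ne'
  have h : (n : ℝ) ^ m * ((n - m).factorial : ℝ) / (n.factorial : ℝ) * (gram φ w x).det =
      (n.descFactorial m : ℝ)⁻¹ * (outerSum (wfeat φ w) x).det := by
    rw [gram_eq_outerSum hw, det_smul, Fintype.card_fin, ← Nat.factorial_mul_descFactorial hmn]
    have := (n - m).factorial_ne_zero
    push_cast
    rw [inv_pow]
    field_simp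
  rw [h, ENNReal.ofReal_mul (by positivity), ENNReal.ofReal_inv_of_pos hd, ENNReal.ofReal_natCast]

end Features

section Deterministic

variable {𝓧 : Type*} {m n : ℕ} {φ u : Fin m → 𝓧 → ℝ} {w : 𝓧 → ℝ}

theorem cDelta_pos {δ : ℝ} (hδ0 : 0 < δ) (hδ1 : δ < 1) : 0 < cDelta δ := by
  have h1 : 0 < 1 - δ := by linarith
  have h2 : (1 - δ)⁻¹ ≠ 1 := by
    rw [Ne, inv_eq_one]
    linarith
  have h3 := Real.log_lt_sub_one_of_pos (inv_pos.2 h1) h2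
  rw [Real.log_inv] at h3
  have h4 := mul_lt_mul_of_pos_left h3 h1
  rw [mul_sub, mul_inv_cancel₀ h1.ne'] at h4
  rw [cDelta]
  linarith

theorem coeff_le_of_lower {δ M : ℝ} (hδ1 : δ < 1) (hmn : m < n) {x : Fin n → 𝓧}
    (hx : ∀ v, (1 - δ) * ((n : ℝ) - m) * (v ⬝ᵥ v) ≤ v ⬝ᵥ (outerSum u x *ᵥ v)) {r : Fin n → ℝ}
    (hr : ∑ i, r i ^ 2 ≤ n * M) {c : Fin m → ℝ}
    (hc : outerSum u x *ᵥ c = ∑ i, r i • feat u (x i)) :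
    c ⬝ᵥ c ≤ (1 - δ)⁻¹ * (1 - (m : ℝ) / n)⁻¹ * M := by
  have h1 : (1 - δ) * ((n : ℝ) - m) * (c ⬝ᵥ c) ≤ n * M :=
    (hx c).trans ((normalEquations_energy_le x r hc).trans hr)
  have hmn' : (m : ℝ) < n := by exact_mod_cast hmn
  have hn : (0 : ℝ) < n := (Nat.cast_nonneg m).trans_lt hmn'
  have h2 : 0 < 1 - δ := by linarith
  have h3 : 0 < (n : ℝ) - m := by linarith
  have h4 : 1 - (m : ℝ) / n = (n - m) / n := by field_simp
  rw [h4, inv_div, mul_assoc, ← div_eq_inv_mul, le_div_iff₀ h2, div_mul_eq_mul_div,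
    le_div_iff₀ h3]
  linarith

theorem ofReal_det_mul_coeff_le {M : ℝ} {k : ℕ} {u : Fin (k + 1) → 𝓧 → ℝ} {x : Fin n → 𝓧}
    {r : Fin n → ℝ} (hr : ∑ i, r i ^ 2 ≤ n * M) {c : Fin (k + 1) → ℝ}
    (hdet : 0 < (outerSum u x).det)
    (hc : outerSum u x *ᵥ c = ∑ i, r i • feat u (x i)) :
    ENNReal.ofReal (outerSum u x).det * ENNReal.ofReal (c ⬝ᵥ c) ≤
      (∑ j : Fin (k + 1), ENNReal.ofReal (outerSum (fun i => u (j.succAbove i)) x).det) *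
        ENNReal.ofReal (n * M) := by
  have h0 : ∀ j : Fin (k + 1), 0 ≤ (outerSum (fun i => u (j.succAbove i)) x).det :=
    fun j => det_outerSum_nonneg _ x
  rw [← ENNReal.ofReal_mul hdet.le, ← ENNReal.ofReal_sum_of_nonneg fun j _ => h0 j,
    ← ENNReal.ofReal_mul (Finset.sum_nonneg fun j _ => h0 j)]
  refine ENNReal.ofReal_le_ofReal ?_
  rw [dotProduct, Finset.mul_sum, Finset.sum_mul]
  refine Finset.sum_le_sum fun j _ => ?_
  rw [← pow_two]
  refine (det_mul_sq_le_adjugate_mul x hdet c j).trans ?_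
  rw [adjugate_outerSum_diag]
  exact mul_le_mul_of_nonneg_left ((normalEquations_energy_le x r hc).trans hr) (h0 j)

theorem sum_weighted_sq_le {h q : 𝓧 → ℝ} {α t : ℝ} (hα1 : α < 1) (hhpos : ∀ y, 0 < h y)
    (hwh : ∀ y, (1 - α) * h y ≤ w y) (hq : ∀ y, |q y| ≤ Real.sqrt (h y) * t) (x : Fin n → 𝓧) :
    ∑ i, ((Real.sqrt (w (x i)))⁻¹ * q (x i)) ^ 2 ≤ n * ((1 - α)⁻¹ * t ^ 2) := by
  have h1 : ∀ y, ((Real.sqrt (w y))⁻¹ * q y) ^ 2 ≤ (1 - α)⁻¹ * t ^ 2 := by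
    intro y
    have hα : 0 < 1 - α := by linarith
    have hwy : 0 < w y := (mul_pos hα (hhpos y)).trans_le (hwh y)
    have h2 : q y ^ 2 ≤ h y * t ^ 2 := by
      rw [← sq_abs, show h y * t ^ 2 = (Real.sqrt (h y) * t) ^ 2 by
        rw [mul_pow, Real.sq_sqrt (hhpos y).le]]
      exact pow_le_pow_left₀ (abs_nonneg _) (hq y) 2
    rw [mul_pow, inv_pow, Real.sq_sqrt hwy.le, inv_mul_le_iff₀ hwy]
    calc q y ^ 2 ≤ h y * t ^ 2 := h2
      _ = ((1 - α) * h y) * ((1 - α)⁻¹ * t ^ 2) := by field_simp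
      _ ≤ _ := mul_le_mul_of_nonneg_right (hwh y) (by positivity)
  calc _ ≤ ∑ _i : Fin n, (1 - α)⁻¹ * t ^ 2 := Finset.sum_le_sum fun i _ => h1 _
    _ = _ := by simp

theorem feat_wfeat_dotProduct_le {h : 𝓧 → ℝ} {α : ℝ} (hm : 0 < m) (hα0 : 0 < α) (hα1 : α < 1)
    (hhpos : ∀ y, 0 < h y) (hw : w = fun x => α * wChr φ x + (1 - α) * h x) (y : 𝓧) :
    feat (wfeat φ w) y ⬝ᵥ feat (wfeat φ w) y ≤ m / α := by
  have hm' : (0 : ℝ) < m := by exact_mod_cast hm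
  have hwChr : 0 ≤ wChr φ y :=
    mul_nonneg (by positivity) (Finset.sum_nonneg fun i _ => sq_nonneg _)
  have hp : 0 < (1 - α) * h y := mul_pos (by linarith) (hhpos y)
  have hle : α * wChr φ y ≤ w y := by
    simp only [hw]
    linarith
  have hwy : 0 < w y := by
    simp only [hw]
    positivity
  have h1 : feat (wfeat φ w) y ⬝ᵥ feat (wfeat φ w) y = (w y)⁻¹ * (m * wChr φ y) := by
    have h2 : (w y)⁻¹ = (Real.sqrt (w y))⁻¹ * (Real.sqrt (w y))⁻¹ := by
      rw [← mul_inv, Real.mul_self_sqrt hwy.le]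
    rw [wChr, mul_inv_cancel_left₀ hm'.ne', dotProduct, Finset.mul_sum, h2]
    refine Finset.sum_congr rfl fun i _ => ?_
    simp only [feat, wfeat]
    ring
  rw [h1, inv_mul_le_iff₀ hwy, mul_div_assoc', le_div_iff₀ hα0]
  nlinarith

theorem sub_lsProj_eq (hw : ∀ y, 0 < w y) (hn : 0 < n) (f : 𝓧 → ℝ) (a : Fin m → ℝ)
    {x : Fin n → 𝓧} (hdet : IsUnit (outerSum (wfeat φ w) x).det) :
    ∃ c : Fin m → ℝ, outerSum (wfeat φ w) x *ᵥ c =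
        ∑ i, ((Real.sqrt (w (x i)))⁻¹ * (f (x i) - lin φ a (x i))) • feat (wfeat φ w) (x i) ∧
      (fun y => f y - lsProj φ w f x y) = fun y => (f y - lin φ a y) - lin φ c y := by
  obtain ⟨c, hc, h⟩ := lsProj_eq_of_isUnit (φ := φ) hw hn f a hdet
  refine ⟨c, hc, ?_⟩
  funext y
  rw [h]
  simp only [lin, add_mul, Finset.sum_add_distrib]
  ring

end Deterministic

section Probability

variable {𝓧 : Type*} [MeasurableSpace 𝓧] {m n : ℕ} {μ : Measure 𝓧}
  {φ : Fin m → 𝓧 → ℝ} {w : 𝓧 → ℝ}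

theorem integral_wChr (hm : 0 < m) (horth : IsONB μ φ) (hφ : ∀ j, Measurable (φ j)) :
    Integrable (wChr φ) μ ∧ ∫ y, wChr φ y ∂μ = 1 := by
  have hi : ∀ j, Integrable (fun y => φ j y ^ 2) μ := fun j => (horth.memLp hφ j).integrable_sq
  refine ⟨(integrable_finsetSum _ fun j _ => hi j).const_mul _, ?_⟩
  simp only [wChr]
  rw [integral_const_mul, integral_finsetSum _ fun j _ => hi j]
  have h1 : ∀ j, ∫ y, φ j y ^ 2 ∂μ = 1 := fun j => by simpa [pow_two] using horth j j
  have hm' : (m : ℝ) ≠ 0 := by exact_mod_cast hm.ne'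
  simp [h1, hm']

theorem integral_mixture {h : 𝓧 → ℝ} {α : ℝ} (hm : 0 < m) (horth : IsONB μ φ)
    (hφ : ∀ j, Measurable (φ j)) (hhint : ∫ y, h y ∂μ = 1) :
    ∫ y, α * wChr φ y + (1 - α) * h y ∂μ = 1 := by
  obtain ⟨h1, h2⟩ := integral_wChr hm horth hφ
  rw [integral_add (h1.const_mul _) ((integrable_of_integral_eq_one hhint).const_mul _),
    integral_const_mul, integral_const_mul, h2, hhint]
  ring

theorem memLp_of_abs_le {h g : 𝓧 → ℝ} {t : ℝ} (hhpos : ∀ y, 0 < h y) (hh : Integrable h μ)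
    (hg : Measurable g) (hgt : ∀ y, |g y| ≤ Real.sqrt (h y) * t) : MemLp g 2 μ := by
  rw [memLp_two_iff_integrable_sq hg.aestronglyMeasurable]
  refine (hh.mul_const (t ^ 2)).mono' (hg.pow_const 2).aestronglyMeasurable (.of_forall fun y => ?_)
  rw [Real.norm_eq_abs, abs_pow]
  calc |g y| ^ 2 ≤ (Real.sqrt (h y) * t) ^ 2 := pow_le_pow_left₀ (abs_nonneg _) (hgt y) 2
    _ = _ := by rw [mul_pow, Real.sq_sqrt (hhpos y).le]

theorem l2Sq_sub_le {g g' : 𝓧 → ℝ} (hg : MemLp g 2 μ) (hg' : MemLp g' 2 μ) :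
    l2Sq μ (fun y => g y - g' y) ≤ 2 * l2Sq μ g + 2 * l2Sq μ g' := by
  have h1 := l2_sub_le hg hg'
  rw [← l2_sq, ← l2_sq g, ← l2_sq g']
  nlinarith [l2_nonneg (μ := μ) (fun y => g y - g' y), l2_nonneg (μ := μ) g,
    l2_nonneg (μ := μ) g', sq_nonneg (l2 μ g - l2 μ g')]

/-- The event that the Gram matrix is well conditioned has large volume-sampling probability. -/
theorem vs_compl_lower_le (hm : 0 < m) (hmn : m < n) [IsProbabilityMeasure (dens μ w)]
    (hφ : ∀ j, Measurable (φ j)) (horth : IsONB μ φ) (hw : ∀ y, 0 < w y) (hwm : Measurable w)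
    {α : ℝ} (hα0 : 0 < α)
    (hb : ∀ y, feat (wfeat φ w) y ⬝ᵥ feat (wfeat φ w) y ≤ m / α)
    {δ : ℝ} (hδ0 : 0 < δ) (hδ1 : δ < 1) :
    vs μ φ w n {x | ∀ v, (1 - δ) * ((n : ℝ) - m) * (v ⬝ᵥ v) ≤
        v ⬝ᵥ (outerSum (wfeat φ w) x *ᵥ v)}ᶜ ≤
      ENNReal.ofReal ((m : ℝ) * Real.exp (-(cDelta δ * ((n : ℝ) - m) * α) / m)) := by
  have : NeZero m := ⟨hm.ne'⟩
  have hm' : (0 : ℝ) < m := by exact_mod_cast hm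
  have hu := measurable_wfeat hφ hwm
  have hB := (measurableSet_outerSum_lower (ι := Fin n) hu ((1 - δ) * ((n : ℝ) - m))).compl
  have hcast : ((n - m : ℕ) : ℝ) = n - m := Nat.cast_sub hmn.le
  have key := lintegral_det_outerSum_lower_tail_le (Nat.add_sub_cancel' hmn.le) hu
    (integrable_wfeat_mul horth hφ hw hwm) (isONB_wfeat horth hw hwm) (div_pos hm' hα0) hb hδ0 hδ1
    (M := (n : ℝ) - m) hcast.ge (Function.Embedding.refl _)
  have hd0 : (n.descFactorial m : ℝ≥0∞) ≠ 0 := by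
    exact_mod_cast (Nat.descFactorial_pos.2 hmn.le).ne'
  have hd1 : (n.descFactorial m : ℝ≥0∞) ≠ ∞ := ENNReal.natCast_ne_top _
  rw [vs_eq_withDensity_det_outerSum hw hmn.le (hm.trans hmn), withDensity_apply _ hB,
    ← lintegral_indicator hB]
  have he : ∀ x : Fin n → 𝓧, ({x | ∀ v, (1 - δ) * ((n : ℝ) - m) * (v ⬝ᵥ v) ≤
        v ⬝ᵥ (outerSum (wfeat φ w) x *ᵥ v)}ᶜ.indicator (fun x =>
      (n.descFactorial m : ℝ≥0∞)⁻¹ * ENNReal.ofReal (outerSum (wfeat φ w) x).det) x) =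
      (n.descFactorial m : ℝ≥0∞)⁻¹ * (ENNReal.ofReal (outerSum (wfeat φ w) x).det *
        {x | ∀ v, (1 - δ) * ((n : ℝ) - m) * (v ⬝ᵥ v) ≤
        v ⬝ᵥ (outerSum (wfeat φ w) x *ᵥ v)}ᶜ.indicator 1 x) := by
    intro x
    by_cases hx : x ∈ {x : Fin n → 𝓧 | ∀ v, (1 - δ) * ((n : ℝ) - m) * (v ⬝ᵥ v) ≤
        v ⬝ᵥ (outerSum (wfeat φ w) x *ᵥ v)}ᶜ
    · rw [Set.indicator_of_mem hx, Set.indicator_of_mem hx, Pi.one_apply, mul_one]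
    · rw [Set.indicator_of_notMem hx, Set.indicator_of_notMem hx, mul_zero, mul_zero]
  rw [lintegral_congr he, lintegral_const_mul' _ _ (ENNReal.inv_ne_top.2 hd0)]
  refine (mul_le_mul_right key _).trans (le_of_eq ?_)
  rw [← mul_assoc, ENNReal.inv_mul_cancel hd0 hd1, one_mul, hcast]
  congr 3
  field_simp

theorem vs_univ (hmn : m < n) [IsProbabilityMeasure (dens μ w)]
    (hφ : ∀ j, Measurable (φ j)) (horth : IsONB μ φ) (hw : ∀ y, 0 < w y) (hwm : Measurable w) :
    vs μ φ w n Set.univ = 1 := by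
  have hd0 : (n.descFactorial m : ℝ≥0∞) ≠ 0 := by
    exact_mod_cast (Nat.descFactorial_pos.2 hmn.le).ne'
  rw [vs_eq_withDensity_det_outerSum hw hmn.le (by omega), withDensity_apply _ .univ,
    setLIntegral_univ, lintegral_const_mul' _ _ (ENNReal.inv_ne_top.2 hd0),
    lintegral_det_outerSum hmn.le (measurable_wfeat hφ hwm) (integrable_wfeat_mul horth hφ hw hwm)
      (isONB_wfeat horth hw hwm), ENNReal.inv_mul_cancel hd0 (ENNReal.natCast_ne_top _)]

end Probability

section Expectation

variable {𝓧 : Type*} [MeasurableSpace 𝓧] {k n : ℕ} {μ : Measure 𝓧}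
  {φ : Fin (k + 1) → 𝓧 → ℝ} {w : 𝓧 → ℝ}

theorem ofReal_det_mul_l2Sq_le (hmn : k + 1 < n) (hφ : ∀ j, Measurable (φ j))
    (horth : IsONB μ φ) (hw : ∀ y, 0 < w y) {f : 𝓧 → ℝ} {a : Fin (k + 1) → ℝ}
    (hq : MemLp (fun y => f y - lin φ a y) 2 μ) {δ M : ℝ} (hδ1 : δ < 1) (hM : 0 ≤ M)
    (x : Fin n → 𝓧)
    (hr : ∑ i, ((Real.sqrt (w (x i)))⁻¹ * (f (x i) - lin φ a (x i))) ^ 2 ≤ n * M) :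
    ENNReal.ofReal (outerSum (wfeat φ w) x).det *
        ENNReal.ofReal (l2Sq μ (fun y => f y - lsProj φ w f x y)) ≤
      ENNReal.ofReal (outerSum (wfeat φ w) x).det *
          ENNReal.ofReal (2 * l2Sq μ (fun y => f y - lin φ a y) +
            2 * ((1 - δ)⁻¹ * (1 - ((k + 1 : ℕ) : ℝ) / n)⁻¹ * M)) +
        ENNReal.ofReal (2 * (n * M)) * ∑ j : Fin (k + 1),
          ENNReal.ofReal (outerSum (fun i => wfeat φ w (j.succAbove i)) x).det *
            {x | ∀ v, (1 - δ) * ((n : ℝ) - (k + 1 : ℕ)) * (v ⬝ᵥ v) ≤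
              v ⬝ᵥ (outerSum (wfeat φ w) x *ᵥ v)}ᶜ.indicator 1 x := by
  have hmn' : ((k + 1 : ℕ) : ℝ) < n := by exact_mod_cast hmn
  have hn : (0 : ℝ) < n := (Nat.cast_nonneg _).trans_lt hmn'
  have hfrac : 0 < 1 - ((k + 1 : ℕ) : ℝ) / n := by
    rw [sub_pos, div_lt_one hn]
    exact hmn'
  have hδ' : 0 < 1 - δ := by linarith
  rcases (det_outerSum_nonneg (wfeat φ w) x).eq_or_lt with hdet | hdet
  · rw [← hdet]
    simp
  obtain ⟨c, hc, he⟩ := sub_lsProj_eq (φ := φ) hw (by omega) f a (isUnit_iff_ne_zero.2 hdet.ne')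
  have hF := l2Sq_sub_le hq (memLp_lin horth hφ c)
  rw [← he, l2Sq_lin horth hφ] at hF
  by_cases hx : x ∈ {x : Fin n → 𝓧 | ∀ v, (1 - δ) * ((n : ℝ) - (k + 1 : ℕ)) * (v ⬝ᵥ v) ≤
      v ⬝ᵥ (outerSum (wfeat φ w) x *ᵥ v)}
  · refine le_trans ?_ le_self_add
    have h1 := coeff_le_of_lower hδ1 hmn hx hr hc
    gcongr
    linarith
  · simp only [Set.indicator_of_mem (Set.mem_compl hx), Pi.one_apply, mul_one]
    have h2 := ofReal_det_mul_coeff_le hr hdet hc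
    have h3 : 0 ≤ l2Sq μ (fun y => f y - lin φ a y) := l2Sq_nonneg _
    have h4 : 0 ≤ c ⬝ᵥ c := Finset.sum_nonneg fun i _ => mul_self_nonneg _
    calc ENNReal.ofReal (outerSum (wfeat φ w) x).det *
          ENNReal.ofReal (l2Sq μ (fun y => f y - lsProj φ w f x y))
        ≤ ENNReal.ofReal (outerSum (wfeat φ w) x).det *
          ENNReal.ofReal (2 * l2Sq μ (fun y => f y - lin φ a y) + 2 * (c ⬝ᵥ c)) := by gcongr
      _ = ENNReal.ofReal (outerSum (wfeat φ w) x).det *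
            ENNReal.ofReal (2 * l2Sq μ (fun y => f y - lin φ a y)) +
          ENNReal.ofReal 2 * (ENNReal.ofReal (outerSum (wfeat φ w) x).det *
            ENNReal.ofReal (c ⬝ᵥ c)) := by
        rw [ENNReal.ofReal_add (by positivity) (by positivity), mul_add,
          ENNReal.ofReal_mul zero_le_two (q := c ⬝ᵥ c)]
        ring
      _ ≤ _ := by
        refine add_le_add ?_ ?_
        · gcongr
          have : 0 ≤ (1 - δ)⁻¹ * (1 - ((k + 1 : ℕ) : ℝ) / n)⁻¹ * M := by positivity
          linarith
        · rw [ENNReal.ofReal_mul zero_le_two (q := (n : ℝ) * M), mul_assoc]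
          exact mul_le_mul_right (h2.trans_eq (mul_comm _ _)) _

theorem lintegral_vs_l2Sq_le (hmn : k + 1 < n) [IsProbabilityMeasure (dens μ w)]
    (hφ : ∀ j, Measurable (φ j)) (horth : IsONB μ φ) (hw : ∀ y, 0 < w y) (hwm : Measurable w)
    {α : ℝ} (hα0 : 0 < α)
    (hb : ∀ y, feat (wfeat φ w) y ⬝ᵥ feat (wfeat φ w) y ≤ (k + 1 : ℕ) / α)
    {δ : ℝ} (hδ0 : 0 < δ) (hδ1 : δ < 1) {f : 𝓧 → ℝ} {a : Fin (k + 1) → ℝ}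
    (hq : MemLp (fun y => f y - lin φ a y) 2 μ) {M : ℝ} (hM : 0 ≤ M)
    (hr : ∀ x : Fin n → 𝓧,
      ∑ i, ((Real.sqrt (w (x i)))⁻¹ * (f (x i) - lin φ a (x i))) ^ 2 ≤ n * M)
    (hsmall : (n : ℝ) * ((k + 1 : ℕ) : ℝ) ^ 2 *
      Real.exp (-(cDelta δ * ((n : ℝ) - (k + 1 : ℕ)) * α) / (k + 1 : ℕ)) ≤ 1) :
    ∫⁻ x, ENNReal.ofReal (l2Sq μ (fun y => f y - lsProj φ w f x y)) ∂(vs μ φ w n) ≤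
      ENNReal.ofReal (2 * l2Sq μ (fun y => f y - lin φ a y) +
            2 * ((1 - δ)⁻¹ * (1 - ((k + 1 : ℕ) : ℝ) / n)⁻¹ * M) + 2 * M) := by
  have hmn' : ((k + 1 : ℕ) : ℝ) < n := by exact_mod_cast hmn
  have hn : (0 : ℝ) < n := (Nat.cast_nonneg _).trans_lt hmn'
  have hk : (0 : ℝ) < (k + 1 : ℕ) := by positivity
  have hfrac : 0 < 1 - ((k + 1 : ℕ) : ℝ) / n := by
    rw [sub_pos, div_lt_one hn]
    exact hmn'
  have hδ' : 0 < 1 - δ := by linarith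
  have hl2 : 0 ≤ l2Sq μ (fun y => f y - lin φ a y) := l2Sq_nonneg _
  set A : ℝ := 2 * l2Sq μ (fun y => f y - lin φ a y) +
    2 * ((1 - δ)⁻¹ * (1 - ((k + 1 : ℕ) : ℝ) / n)⁻¹ * M) with hA
  have hA0 : 0 ≤ A := by positivity
  have hu := measurable_wfeat hφ hwm
  have hint := integrable_wfeat_mul horth hφ hw hwm
  have hONB := isONB_wfeat horth hw hwm
  have hd0 : (n.descFactorial (k + 1) : ℝ≥0∞) ≠ 0 := by
    exact_mod_cast (Nat.descFactorial_pos.2 hmn.le).ne'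
  have hd1 : (n.descFactorial (k + 1) : ℝ≥0∞) ≠ ∞ := ENNReal.natCast_ne_top _
  have hdi := ENNReal.inv_ne_top.2 hd0
  have hdetm : ∀ {l : ℕ} (ρ : Fin l → Fin (k + 1)), Measurable fun x : Fin n → 𝓧 =>
      ENNReal.ofReal (outerSum (fun i => wfeat φ w (ρ i)) x).det := fun ρ =>
    (measurable_continuous_comp_matrix
      (fun i j => measurable_outerSum_apply (fun i => hu (ρ i)) i j)
      (continuous_id.matrix_det)).ennreal_ofReal
  have hdm : Measurable fun x : Fin n → 𝓧 => ENNReal.ofReal (outerSum (wfeat φ w) x).det :=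
    hdetm id
  set B : Set (Fin n → 𝓧) := {x | ∀ v, (1 - δ) * ((n : ℝ) - (k + 1 : ℕ)) * (v ⬝ᵥ v) ≤
    v ⬝ᵥ (outerSum (wfeat φ w) x *ᵥ v)}ᶜ with hBdef
  have hB : MeasurableSet B := (measurableSet_outerSum_lower hu _).compl
  have hcast : ((n - k : ℕ) : ℝ) = n - k := Nat.cast_sub (by omega)
  have key : ∀ j : Fin (k + 1), ∫⁻ x : Fin n → 𝓧,
      ENNReal.ofReal (outerSum (fun i => wfeat φ w (j.succAbove i)) x).det * B.indicator 1 x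
        ∂(Measure.pi fun _ => dens μ w) ≤
      n.descFactorial k * ENNReal.ofReal ((k + 1 : ℕ) *
        Real.exp (-(cDelta δ * (n - k : ℕ) / ((k + 1 : ℕ) / α)))) := fun j =>
    lintegral_det_outerSum_lower_tail_le (Nat.add_sub_cancel' (by omega)) hu hint hONB
      (div_pos hk hα0) hb hδ0 hδ1 (M := (n : ℝ) - (k + 1 : ℕ))
      (by rw [hcast]; push_cast; linarith) j.succAboveEmb
  rw [vs_eq_withDensity_det_outerSum hw hmn.le (by omega)]
  refine (lintegral_withDensity_le_lintegral_mul _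
    (hdm.const_mul _) _).trans ?_
  calc ∫⁻ x, (n.descFactorial (k + 1) : ℝ≥0∞)⁻¹ *
            ENNReal.ofReal (outerSum (wfeat φ w) x).det *
          ENNReal.ofReal (l2Sq μ (fun y => f y - lsProj φ w f x y))
        ∂(Measure.pi fun _ => dens μ w)
      ≤ ∫⁻ x, (n.descFactorial (k + 1) : ℝ≥0∞)⁻¹ *
          (ENNReal.ofReal (outerSum (wfeat φ w) x).det * ENNReal.ofReal A +
          ENNReal.ofReal (2 * (n * M)) * ∑ j : Fin (k + 1),
            ENNReal.ofReal (outerSum (fun i => wfeat φ w (j.succAbove i)) x).det *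
              B.indicator 1 x) ∂(Measure.pi fun _ => dens μ w) := by
        refine lintegral_mono fun x => ?_
        rw [mul_assoc]
        gcongr
        exact ofReal_det_mul_l2Sq_le hmn hφ horth hw hq hδ1 hM x (hr x)
    _ = (n.descFactorial (k + 1) : ℝ≥0∞)⁻¹ *
          (n.descFactorial (k + 1) * ENNReal.ofReal A +
          ENNReal.ofReal (2 * (n * M)) * ∑ j : Fin (k + 1), ∫⁻ x : Fin n → 𝓧,
            ENNReal.ofReal (outerSum (fun i => wfeat φ w (j.succAbove i)) x).det *
              B.indicator 1 x ∂(Measure.pi fun _ => dens μ w)) := by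
        rw [lintegral_const_mul' _ _ hdi,
          lintegral_add_left (hdm.mul_const _), lintegral_mul_const' _ _ ENNReal.ofReal_ne_top,
          lintegral_const_mul' _ _ ENNReal.ofReal_ne_top,
          lintegral_det_outerSum hmn.le hu hint hONB]
        congr 3
        exact lintegral_finsetSum Finset.univ (f := fun (j : Fin (k + 1)) (x : Fin n → 𝓧) =>
          ENNReal.ofReal (outerSum (fun i => wfeat φ w (j.succAbove i)) x).det *
            B.indicator 1 x) fun j _ => (hdetm j.succAbove).mul (measurable_one.indicator hB)
    _ ≤ (n.descFactorial (k + 1) : ℝ≥0∞)⁻¹ *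
          (n.descFactorial (k + 1) * ENNReal.ofReal A +
            n.descFactorial (k + 1) * ENNReal.ofReal (2 * M)) := by
        refine mul_le_mul_right (add_le_add le_rfl ?_) _
        refine (mul_le_mul_right (Finset.sum_le_sum fun j _ => key j) _).trans ?_
        rw [Finset.sum_const, Finset.card_univ, Fintype.card_fin, nsmul_eq_mul,
          ← ENNReal.ofReal_natCast (n.descFactorial k),
          ← ENNReal.ofReal_natCast (n.descFactorial (k + 1)),
          ← ENNReal.ofReal_natCast (k + 1), ← ENNReal.ofReal_mul (by positivity),
          ← ENNReal.ofReal_mul (by positivity), ← ENNReal.ofReal_mul (by positivity),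
          ← ENNReal.ofReal_mul (by positivity)]
        refine ENNReal.ofReal_le_ofReal ?_
        have hexp : Real.exp (-(cDelta δ * (n - k : ℕ) / ((k + 1 : ℕ) / α))) ≤
            Real.exp (-(cDelta δ * ((n : ℝ) - (k + 1 : ℕ)) * α) / (k + 1 : ℕ)) := by
          rw [Real.exp_le_exp, neg_div, neg_le_neg_iff, div_div_eq_mul_div]
          have := cDelta_pos hδ0 hδ1
          gcongr
          rw [hcast]
          push_cast
          linarith
        have hN : (1 : ℝ) ≤ (n - k : ℕ) := by
          rw [Nat.one_le_cast]
          omega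
        rw [Nat.descFactorial_succ]
        push_cast only [Nat.cast_mul]
        set E := Real.exp (-(cDelta δ * (n - k : ℕ) / ((k + 1 : ℕ) / α)))
        have hsm : (n : ℝ) * ((k + 1 : ℕ) : ℝ) ^ 2 * E ≤ 1 :=
          le_trans (by gcongr) hsmall
        calc 2 * ((n : ℝ) * M) * (((k + 1 : ℕ) : ℝ) *
              ((n.descFactorial k : ℝ) * (((k + 1 : ℕ) : ℝ) * E)))
            = ((n : ℝ) * ((k + 1 : ℕ) : ℝ) ^ 2 * E) * ((n.descFactorial k : ℝ) * (2 * M)) := by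
              ring
          _ ≤ ((n - k : ℕ) : ℝ) * ((n.descFactorial k : ℝ) * (2 * M)) := by
              gcongr
              exact hsm.trans hN
          _ = _ := by ring
    _ = ENNReal.ofReal (A + 2 * M) := by
        rw [← mul_add, ← mul_assoc, ENNReal.inv_mul_cancel hd0 hd1, one_mul,
          ENNReal.ofReal_add hA0 (by positivity)]

end Expectation

end WLSDPP

open WLSDPP in
/-- `H → L²_μ` quasi-optimality under volume sampling from the mixture
`w = α w_m + (1−α) h`, in probability and in expectation. -/
theorem statement14 {𝓧 : Type*} [MeasurableSpace 𝓧] {m n : ℕ} (hm : 0 < m) (hmn : m < n)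
    (μ : Measure 𝓧) [IsProbabilityMeasure μ]
    (φ : Fin m → 𝓧 → ℝ) (hφ : ∀ j, Measurable (φ j)) (horth : IsONB μ φ)
    (h : 𝓧 → ℝ) (hhpos : ∀ x, 0 < h x) (hh : Measurable h) (hhint : ∫ y, h y ∂μ = 1)
    (H : Submodule ℝ (𝓧 → ℝ)) (normH : (𝓧 → ℝ) → ℝ) (C_H : ℝ)
    (hemb : ∀ g ∈ H, l2 μ g ≤ C_H * normH g)
    (hsup : ∀ g ∈ H, ∀ x, |g x| ≤ Real.sqrt (h x) * normH g)
    (hVH : ∀ a : Fin m → ℝ, lin φ a ∈ H)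
    (f : 𝓧 → ℝ) (hfH : f ∈ H) (hfmeas : Measurable f)
    {α : ℝ} (hα0 : 0 < α) (hα1 : α < 1)
    (w : 𝓧 → ℝ) (hw : w = fun x => α * wChr φ x + (1 - α) * h x)
    (γ : Measure (Fin n → 𝓧)) (hγ : γ = vs μ φ w n)
    {δ : ℝ} (hδ0 : 0 < δ) (hδ1 : δ < 1) :
    (ENNReal.ofReal (1 - (m : ℝ) * Real.exp (-(cDelta δ * ((n : ℝ) - m) * α) / m)) ≤
      γ {x | l2 μ (fun y => f y - lsProj φ w f x y)
              ≤ (C_H + Real.sqrt (1 - δ)⁻¹ * Real.sqrt (1 - α)⁻¹ *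
                    Real.sqrt (1 - (m : ℝ) / n)⁻¹) *
                  ⨅ a : Fin m → ℝ, normH (fun y => f y - lin φ a y)}) ∧
    ((n : ℝ) ≥ m + (cDelta δ)⁻¹ * α⁻¹ * m * Real.log ((n : ℝ) * (m : ℝ) ^ 2) →
      ∫ x, l2Sq μ (fun y => f y - lsProj φ w f x y) ∂γ
        ≤ (2 * C_H ^ 2 +
              2 * (1 - α)⁻¹ * (1 + (1 - δ)⁻¹ * (1 - (m : ℝ) / n)⁻¹)) *
            (⨅ a : Fin m → ℝ, normH (fun y => f y - lin φ a y)) ^ 2) := by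
  have hw' : ∀ y, w y = α * wChr φ y + (1 - α) * h y := fun y => by rw [hw]
  have hα : 0 < 1 - α := by linarith
  have hδ : 0 < 1 - δ := by linarith
  have hmR : (0 : ℝ) < m := by exact_mod_cast hm
  have hmnR : (m : ℝ) < n := by exact_mod_cast hmn
  have hnR : (0 : ℝ) < n := hmR.trans hmnR
  have hfrac : 0 < 1 - (m : ℝ) / n := by
    rw [sub_pos, div_lt_one hnR]
    exact hmnR
  have hwh : ∀ y, (1 - α) * h y ≤ w y := by
    intro y
    have : 0 ≤ wChr φ y :=
      mul_nonneg (by positivity) (Finset.sum_nonneg fun i _ => sq_nonneg _)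
    rw [hw']
    have := mul_nonneg hα0.le this
    linarith
  have hwpos : ∀ y, 0 < w y := fun y => (mul_pos hα (hhpos y)).trans_le (hwh y)
  have hwm : Measurable w := by
    rw [hw]
    unfold wChr
    fun_prop
  have hwint : ∫ y, w y ∂μ = 1 := by
    rw [hw]
    exact integral_mixture hm horth hφ hhint
  have := isProbabilityMeasure_dens hwpos hwint
  have hb := feat_wfeat_dotProduct_le (φ := φ) hm hα0 hα1 hhpos hw
  have hmem : ∀ a, (fun y => f y - lin φ a y) ∈ H := fun a => H.sub_mem hfH (hVH a)
  have hq : ∀ a, MemLp (fun y => f y - lin φ a y) 2 μ := fun a =>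
    memLp_of_abs_le hhpos (integrable_of_integral_eq_one hhint)
      (hfmeas.sub (measurable_lin hφ a)) (hsup _ (hmem a))
  obtain ⟨y₀⟩ : Nonempty 𝓧 := nonempty_of_isProbabilityMeasure μ
  have ht : ∀ a, 0 ≤ normH (fun y => f y - lin φ a y) := fun a =>
    nonneg_of_mul_nonneg_right ((abs_nonneg _).trans (hsup _ (hmem a) y₀))
      (Real.sqrt_pos.2 (hhpos y₀))
  have hr : ∀ a (x : Fin n → 𝓧),
      ∑ i, ((Real.sqrt (w (x i)))⁻¹ * (f (x i) - lin φ a (x i))) ^ 2 ≤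
        n * ((1 - α)⁻¹ * normH (fun y => f y - lin φ a y) ^ 2) := fun a x =>
    sum_weighted_sq_le hα1 hhpos hwh (hsup _ (hmem a)) x
  have hl2sq : ∀ a, l2Sq μ (fun y => f y - lin φ a y) ≤
      C_H ^ 2 * normH (fun y => f y - lin φ a y) ^ 2 := by
    intro a
    rw [← l2_sq, ← mul_pow]
    exact pow_le_pow_left₀ (l2_nonneg _) (hemb _ (hmem a)) 2
  subst hγ
  refine ⟨?_, fun hn => ?_⟩
  · set s : ℝ := Real.sqrt (1 - δ)⁻¹ * Real.sqrt (1 - α)⁻¹ * Real.sqrt (1 - (m : ℝ) / n)⁻¹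
      with hs
    have hgood : ∀ x : Fin n → 𝓧, (∀ v, (1 - δ) * ((n : ℝ) - m) * (v ⬝ᵥ v) ≤
        v ⬝ᵥ (outerSum (wfeat φ w) x *ᵥ v)) → ∀ a,
        l2 μ (fun y => f y - lsProj φ w f x y) ≤
          (C_H + s) * normH (fun y => f y - lin φ a y) := by
      intro x hx a
      have hdet := isUnit_det_of_dotProduct_lower (mul_pos hδ (sub_pos.2 hmnR)) hx
      obtain ⟨c, hc, he⟩ := sub_lsProj_eq (φ := φ) hwpos (hm.trans hmn) f a hdet
      rw [he, add_mul]
      refine (l2_sub_le (hq a) (memLp_lin horth hφ c)).trans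
        (add_le_add (hemb _ (hmem a)) ?_)
      have hcc := coeff_le_of_lower hδ1 hmn hx (hr a x) hc
      rw [l2, l2Sq_lin horth hφ]
      refine Real.sqrt_le_iff.2 ⟨mul_nonneg (by positivity) (ht a), hcc.trans_eq ?_⟩
      rw [hs, mul_pow, mul_pow, mul_pow, Real.sq_sqrt (by positivity),
        Real.sq_sqrt (by positivity), Real.sq_sqrt (by positivity)]
      ring
    have hsub : {x : Fin n → 𝓧 | ∀ v, (1 - δ) * ((n : ℝ) - m) * (v ⬝ᵥ v) ≤
        v ⬝ᵥ (outerSum (wfeat φ w) x *ᵥ v)} ⊆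
        {x | l2 μ (fun y => f y - lsProj φ w f x y) ≤
          (C_H + s) * ⨅ a : Fin m → ℝ, normH (fun y => f y - lin φ a y)} := by
      intro x hx
      have hg := hgood x hx
      have hCs : 0 ≤ C_H + s ∨ ∀ a, normH (fun y => f y - lin φ a y) = 0 := by
        by_contra! hcon
        obtain ⟨h1, a, h2⟩ := hcon
        have h3 := (l2_nonneg _).trans (hg a)
        have h4 := lt_of_le_of_ne (ht a) h2.symm
        exact absurd h3 (not_le.2 (mul_neg_of_neg_of_pos h1 h4))
      rcases hCs with hCs | hz
      · rw [Set.mem_ofPred_eq, Real.mul_iInf_of_nonneg hCs]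
        exact le_ciInf hg
      · have h1 := hg 0
        simpa [hz] using h1
    have huniv := vs_univ hmn hφ horth hwpos hwm
    have hbad := vs_compl_lower_le hm hmn hφ horth hwpos hwm hα0 hb hδ0 hδ1
    rw [ENNReal.ofReal_sub _ (by positivity), ENNReal.ofReal_one, tsub_le_iff_right, ← huniv,
      ← Set.union_compl_self {x : Fin n → 𝓧 | ∀ v, (1 - δ) * ((n : ℝ) - m) * (v ⬝ᵥ v) ≤
        v ⬝ᵥ (outerSum (wfeat φ w) x *ᵥ v)}]
    exact (measure_union_le _ _).trans (add_le_add (measure_mono hsub) hbad)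
  · set K : ℝ := 2 * C_H ^ 2 + 2 * (1 - α)⁻¹ * (1 + (1 - δ)⁻¹ * (1 - (m : ℝ) / n)⁻¹) with hK
    have hK0 : 0 < K := by positivity
    have hsmall : (n : ℝ) * (m : ℝ) ^ 2 *
        Real.exp (-(cDelta δ * ((n : ℝ) - m) * α) / m) ≤ 1 := by
      have hcδ := cDelta_pos hδ0 hδ1
      have hpos : (0 : ℝ) < n * (m : ℝ) ^ 2 := by positivity
      have h1 : Real.log ((n : ℝ) * (m : ℝ) ^ 2) ≤ cDelta δ * ((n : ℝ) - m) * α / m := by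
        have h2 : (cDelta δ)⁻¹ * α⁻¹ * m * Real.log ((n : ℝ) * (m : ℝ) ^ 2) ≤ n - m := by
          linarith
        calc Real.log ((n : ℝ) * (m : ℝ) ^ 2) = cDelta δ * ((cDelta δ)⁻¹ * α⁻¹ * m *
              Real.log ((n : ℝ) * (m : ℝ) ^ 2)) * α / m := by field_simp
          _ ≤ _ := by gcongr
      rw [neg_div, Real.exp_neg, ← div_eq_mul_inv, div_le_one (Real.exp_pos _)]
      exact (Real.log_le_iff_le_exp hpos).1 h1
    have hexp : ∀ a, ∫ x, l2Sq μ (fun y => f y - lsProj φ w f x y) ∂(vs μ φ w n) ≤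
        K * normH (fun y => f y - lin φ a y) ^ 2 := by
      intro a
      obtain ⟨k, rfl⟩ := Nat.exists_eq_succ_of_ne_zero hm.ne'
      set t := normH (fun y => f y - lin φ a y) with ht'
      have hle := lintegral_vs_l2Sq_le hmn hφ horth hwpos hwm hα0 hb hδ0 hδ1 (hq a)
        (by positivity) (hr a) hsmall
      have hle' := hle.trans (ENNReal.ofReal_le_ofReal (q := K * t ^ 2) (by
        have := hl2sq a
        rw [← ht'] at this
        rw [hK]
        simp only [Nat.succ_eq_add_one] at *
        nlinarith))
      by_cases hi : Integrable (fun x => l2Sq μ (fun y => f y - lsProj φ w f x y))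
          (vs μ φ w n)
      · rw [← ofReal_integral_eq_lintegral_ofReal hi (.of_forall fun x => l2Sq_nonneg _)] at hle'
        exact (ENNReal.ofReal_le_ofReal_iff (by positivity)).1 hle'
      · rw [integral_undef hi]
        positivity
    set I := ∫ x, l2Sq μ (fun y => f y - lsProj φ w f x y) ∂(vs μ φ w n) with hI
    have hI0 : 0 ≤ I := integral_nonneg fun x => l2Sq_nonneg _
    have hsqrt : Real.sqrt (I / K) ≤ ⨅ a : Fin m → ℝ, normH (fun y => f y - lin φ a y) := by
      refine le_ciInf fun a => Real.sqrt_le_iff.2 ⟨ht a, ?_⟩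
      rw [div_le_iff₀ hK0, mul_comm]
      exact hexp a
    have hfin := pow_le_pow_left₀ (Real.sqrt_nonneg _) hsqrt 2
    rw [Real.sq_sqrt (by positivity), div_le_iff₀ hK0, mul_comm] at hfin
    exact hfin
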